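/- arXiv:2311.06484 — 3 statements merged into one kernel-verified Lean document; each statement's English description precedes it below -/
import Mathlib

section
/- Let p > 1 and set α = (p+1)/2. For any real numbers a, b > 0 satisfying a + b = 1 - 1/p, there exist exponents q, r ∈ [1, ∞) with 1/q + 1/r - 1/p = 1 such that C(p,q,r)^{-αp/(p-1)} · a^{p(q-1)/(q(p-1))} · b^{p(r-1)/(r(p-1))} ≥ 1 - 1/p, where C(p,q,r) is the sharp Young constant. -/
open MeasureTheory Real

noncomputable section

/-- `f` is a probability density function on `ℝ^d`. -/
def IsDensity (d : ℕ) (f : (Fin d → ℝ) → ℝ) : Prop :=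
  Measurable f ∧ (∀ x, 0 ≤ f x) ∧ ∫ x : Fin d → ℝ, f x = 1

/-- The `p`-Rényi entropy `H_p(f) = (1/(1-p)) log ∫ f^p`. -/
def renyiH (d : ℕ) (p : ℝ) (f : (Fin d → ℝ) → ℝ) : ℝ :=
  (1 / (1 - p)) * Real.log (∫ x : Fin d → ℝ, f x ^ p)

/-- The `p`-Rényi entropy power `V_p(f) = exp((2/d) H_p(f))`. -/
def renyiV (d : ℕ) (p : ℝ) (f : (Fin d → ℝ) → ℝ) : ℝ :=
  Real.exp ((2 / (d : ℝ)) * renyiH d p f)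

/-- The differential (Shannon) entropy `H(f) = -∫ f log f`. -/
def shannonH (d : ℕ) (f : (Fin d → ℝ) → ℝ) : ℝ :=
  -∫ x : Fin d → ℝ, f x * Real.log (f x)

/-- The (Shannon) entropy power `V(f) = exp((2/d) H(f))`. -/
def shannonV (d : ℕ) (f : (Fin d → ℝ) → ℝ) : ℝ :=
  Real.exp ((2 / (d : ℝ)) * shannonH d f)

/-- Convolution of two densities on `ℝ^d`: `(f ⋆ g)(z) = ∫ f(x) g(z - x) dx`. -/
def conv (d : ℕ) (f g : (Fin d → ℝ) → ℝ) : (Fin d → ℝ) → ℝ :=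
  fun z => ∫ x : Fin d → ℝ, f x * g (z - x)

/-- The density `x ↦ t^{-d/2} f(x/√t)` of `√t · X` when `X ~ f`. -/
def scaleDensity (d : ℕ) (t : ℝ) (f : (Fin d → ℝ) → ℝ) : (Fin d → ℝ) → ℝ :=
  fun x => t ^ (-(d : ℝ) / 2) * f ((Real.sqrt t)⁻¹ • x)

/-- The density of `√t · X + √(1-t) · Y` for independent `X ~ f`, `Y ~ g`. -/
def wconv (d : ℕ) (t : ℝ) (f g : (Fin d → ℝ) → ℝ) : (Fin d → ℝ) → ℝ :=
  conv d (scaleDensity d t f) (scaleDensity d (1 - t) g)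

/-- `A_s = s^{1/s} / (s')^{1/s'}` where `s' = s/(s-1)`; the limiting value `A_1 = 1`
is obtained automatically since `(1/0)^0 = 1` under Lean's conventions. -/
def youngA (s : ℝ) : ℝ := s ^ (1 / s) / (s / (s - 1)) ^ (1 - 1 / s)

/-- The sharp Young constant `C(p,q,r) = A_q A_r / A_p`. -/
def youngC (p q r : ℝ) : ℝ := youngA q * youngA r / youngA p

/-- If the coefficients `f` change sign at most once, from nonnegative to nonpositive, and sum
to zero, then the power series they define is nonnegative on `[0, 1]`. -/
theorem hasSum_nonneg_of_sign_change {f : ℕ → ℝ} {c F : ℝ} (hc0 : 0 ≤ c) (hc1 : c ≤ 1)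
    (hf : HasSum f 0) (hF : HasSum (fun k => f k * c ^ k) F)
    (hsign : ∀ k, f k < 0 → f (k + 1) < 0) : 0 ≤ F := by
  by_cases hneg : ∃ N, f N < 0
  · classical
    have hN : f (Nat.find hneg) < 0 := Nat.find_spec hneg
    have hlt : ∀ k, k < Nat.find hneg → 0 ≤ f k := fun k hk => not_lt.1 (Nat.find_min hneg hk)
    generalize Nat.find hneg = N at hN hlt
    have hge : ∀ k, N ≤ k → f k < 0 := fun k hk => Nat.le_induction hN (fun m _ => hsign m) k hk
    have hmul := hf.mul_right (c ^ N)
    rw [zero_mul] at hmul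
    refine hasSum_le (fun k => ?_) hmul hF
    rcases lt_or_ge k N with hk | hk
    · exact mul_le_mul_of_nonneg_left (pow_le_pow_of_le_one hc0 hc1 hk.le) (hlt k hk)
    · exact mul_le_mul_of_nonpos_left (pow_le_pow_of_le_one hc0 hc1 hk) (hge k hk).le
  · push Not at hneg
    exact hF.nonneg fun k => mul_nonneg (hneg k) (pow_nonneg hc0 k)

/-- The expansion `(1 - u) log (1 - u) = -u + ∑ u ^ n / (n (n - 1))`, including `u = 1`. -/
theorem hasSum_one_sub_mul_log_one_sub {u : ℝ} (hu0 : 0 ≤ u) (hu1 : u ≤ 1) :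
    HasSum (fun k : ℕ => u ^ (k + 2) / (((k : ℝ) + 1) * (k + 2)))
      (u + (1 - u) * log (1 - u)) := by
  rcases hu1.eq_or_lt with rfl | hlt
  · rw [hasSum_iff_tendsto_nat_of_nonneg (fun k => by positivity)]
    have hsum : ∀ n : ℕ, ∑ k ∈ Finset.range n, (1 : ℝ) ^ (k + 2) / (((k : ℝ) + 1) * (k + 2))
        = 1 - 1 / ((n : ℝ) + 1) := by
      intro n
      induction n with
      | zero => simp
      | succ n ih =>
        rw [Finset.sum_range_succ, ih]
        push_cast
        field_simp
        ring
    simp_rw [hsum]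
    simpa using tendsto_one_div_add_atTop_nhds_zero_nat.const_sub (1 : ℝ)
  · have h := hasSum_pow_div_log_of_abs_lt_one (x := u) (by rwa [abs_of_nonneg hu0])
    have htail := (hasSum_nat_add_iff' 1).2 h
    have hdiff := (h.mul_left u).sub htail
    convert hdiff using 1
    · rfl
    · funext k
      push_cast
      field_simp
      ring
    · simp
      ring

/-- The geometric expansion of `c ^ 2 / (2 - c)`, divided by `c ^ 2`. -/
theorem hasSum_pow_div_two_pow {c : ℝ} (hc0 : 0 ≤ c) (hc1 : c ≤ 1) :
    HasSum (fun k : ℕ => c ^ k / 2 ^ (k + 1)) (1 / (2 - c)) := by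
  have h := (hasSum_geometric_of_lt_one (r := c / 2) (by linarith) (by linarith)).mul_left (1 / 2)
  convert h using 1
  · rfl
  · funext k
    rw [div_pow, pow_succ]
    field_simp
  · have : 2 - c ≠ 0 := by linarith
    have : 1 - c / 2 ≠ 0 := by linarith
    field_simp

theorem weighted_one_sub_pow_le {t s : ℝ} (ht : 0 ≤ t) (hs : 0 ≤ s) (hts : t + s = 1) (k : ℕ) :
    (k + 3) * (1 - t ^ (k + 2) - s ^ (k + 2))
      ≤ 2 * (k + 1) * (1 - t ^ (k + 3) - s ^ (k + 3)) := by
  obtain rfl : s = 1 - t := by linarith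
  rcases k with _ | k
  · norm_num
    nlinarith
  · have h1 : t ^ (k + 1 + 3) ≤ t ^ (k + 1 + 2) :=
      pow_le_pow_of_le_one ht (by linarith) (by omega)
    have h2 : (1 - t) ^ (k + 1 + 3) ≤ (1 - t) ^ (k + 1 + 2) :=
      pow_le_pow_of_le_one hs (by linarith) (by omega)
    have h3 : t ^ (k + 1 + 3) ≤ t := pow_le_of_le_one ht (by linarith) (by omega)
    have h4 : (1 - t) ^ (k + 1 + 3) ≤ 1 - t := pow_le_of_le_one hs (by linarith) (by omega)
    push_cast
    have hk : (0 : ℝ) ≤ k := k.cast_nonneg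
    calc ((k : ℝ) + 1 + 3) * (1 - t ^ (k + 1 + 2) - (1 - t) ^ (k + 1 + 2))
        ≤ (k + 1 + 3) * (1 - t ^ (k + 1 + 3) - (1 - t) ^ (k + 1 + 3)) := by gcongr
      _ ≤ 2 * (k + 1 + 1) * (1 - t ^ (k + 1 + 3) - (1 - t) ^ (k + 1 + 3)) :=
          mul_le_mul_of_nonneg_right (by linarith) (by linarith)

/-- Comparison of the defect of additivity of `u ↦ (1 - u) log (1 - u)` with that of
`u ↦ u log u`. -/
theorem log_defect_le {c t s : ℝ} (hc0 : 0 < c) (hc1 : c < 1) (ht : 0 < t) (hs : 0 < s)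
    (hts : t + s = 1) :
    (2 - c) * ((1 - c) * log (1 - c) - (1 - c * t) * log (1 - c * t)
      - (1 - c * s) * log (1 - c * s)) ≤ c ^ 2 * (-(t * log t) - s * log s) := by
  set H : ℝ := -(t * log t) - s * log s with hH
  let f : ℕ → ℝ := fun k => H * (1 / 2 ^ (k + 1))
    - (1 - t ^ (k + 2) - s ^ (k + 2)) / (((k : ℝ) + 1) * (k + 2))
  have hf : HasSum f 0 := by
    have h := ((hasSum_pow_div_two_pow zero_le_one le_rfl).mul_left H).sub
      (((hasSum_one_sub_mul_log_one_sub zero_le_one le_rfl).sub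
        (hasSum_one_sub_mul_log_one_sub ht.le (by linarith))).sub
        (hasSum_one_sub_mul_log_one_sub hs.le (by linarith)))
    convert h using 1
    · rfl
    · funext k
      simp only [f, one_pow]
      ring
    · rw [show 1 - t = s by linarith, show 1 - s = t by linarith, hH]
      norm_num
      linarith
  have hct : c * t ≤ 1 := by nlinarith
  have hcs : c * s ≤ 1 := by nlinarith
  have hF : HasSum (fun k => f k * c ^ k) (H * (1 / (2 - c)) -
      ((1 - c) * log (1 - c) - (1 - c * t) * log (1 - c * t)
        - (1 - c * s) * log (1 - c * s)) / c ^ 2) := by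
    have h := ((hasSum_pow_div_two_pow hc0.le hc1.le).mul_left H).sub
      ((((hasSum_one_sub_mul_log_one_sub hc0.le hc1.le).sub
        (hasSum_one_sub_mul_log_one_sub (by positivity) hct)).sub
        (hasSum_one_sub_mul_log_one_sub (by positivity) hcs)).div_const (c ^ 2))
    convert h using 1
    · rfl
    · funext k
      simp only [f, mul_pow, pow_add c]
      field_simp
    · obtain rfl : s = 1 - t := by linarith
      ring
  have hsign : ∀ k, f k < 0 → f (k + 1) < 0 := by
    intro k hk
    have hw := weighted_one_sub_pow_le ht.le hs.le hts k
    have hstep : (1 - t ^ (k + 2) - s ^ (k + 2)) / (((k : ℝ) + 1) * (k + 2))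
        ≤ 2 * ((1 - t ^ (k + 3) - s ^ (k + 3)) / (((k : ℝ) + 2) * (k + 3))) := by
      rw [mul_div_assoc', div_le_div_iff₀ (by positivity) (by positivity)]
      have := mul_le_mul_of_nonneg_left hw (by positivity : (0 : ℝ) ≤ k + 2)
      linarith
    have hsucc : f (k + 1) = H * (1 / 2 ^ (k + 1)) / 2
        - (1 - t ^ (k + 3) - s ^ (k + 3)) / (((k : ℝ) + 2) * (k + 3)) := by
      simp only [f]
      push_cast
      rw [show k + 1 + 2 = k + 3 by ring, show (k : ℝ) + 1 + 1 = k + 2 by ring,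
        show (k : ℝ) + 1 + 2 = k + 3 by ring, pow_succ (2 : ℝ) (k + 1)]
      field_simp
    simp only [f] at hk
    linarith
  have hnonneg := hasSum_nonneg_of_sign_change hc0.le hc1.le hf hF hsign
  have h2c : 0 < 2 - c := by linarith
  rw [sub_nonneg, mul_one_div, div_le_div_iff₀ (by positivity) h2c] at hnonneg
  linarith

theorem youngA_one_div_one_sub {u : ℝ} (hu0 : 0 < u) (hu1 : u < 1) :
    youngA (1 / (1 - u)) = exp (u * log u - (1 - u) * log (1 - u)) := by
  have h1 : 0 < 1 - u := by linarith
  have hconj : 1 / (1 - u) / (1 / (1 - u) - 1) = u⁻¹ := by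
    have : 1 / (1 - u) - 1 = u / (1 - u) := by
      field_simp
      ring
    rw [this]
    field_simp
  rw [youngA, hconj, one_div_one_div, sub_sub_cancel, one_div, rpow_def_of_pos (inv_pos.2 h1),
    rpow_def_of_pos (inv_pos.2 hu0), ← exp_sub, log_inv, log_inv]
  ring_nf

/-- **Sharp Young's constant (Lemma 1, Bobkov–Marsiglietti).**
For `p > 1`, `α = (p+1)/2`, and `a, b > 0` with `a + b = 1 - 1/p`, there exist
`q, r ∈ [1, ∞)` with `1/q + 1/r - 1/p = 1` such that
`C(p,q,r)^{-αp/(p-1)} a^{p(q-1)/(q(p-1))} b^{p(r-1)/(r(p-1))} ≥ 1 - 1/p`. -/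
theorem sharp_young_constant (p α a b : ℝ) (hp : 1 < p) (hα : α = (p + 1) / 2)
    (ha : 0 < a) (hb : 0 < b) (hab : a + b = 1 - 1 / p) :
    ∃ q r : ℝ, 1 ≤ q ∧ 1 ≤ r ∧ 1 / q + 1 / r - 1 / p = 1 ∧
      youngC p q r ^ (-(α * p) / (p - 1)) *
        a ^ (p * (q - 1) / (q * (p - 1))) * b ^ (p * (r - 1) / (r * (p - 1)))
      ≥ 1 - 1 / p := by
  obtain ⟨c, hc⟩ : ∃ c, c = 1 - 1 / p := ⟨_, rfl⟩
  have hp0 : 0 < p := by linarith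
  have hc0 : 0 < c := by linarith
  have hc1 : c < 1 := by
    have : 0 < 1 / p := by positivity
    linarith
  have h1c : 0 < 1 - c := by linarith
  have hpc : p = 1 / (1 - c) := by rw [hc, sub_sub_cancel, one_div_one_div]
  rw [← hc] at hab ⊢
  have h1a : 0 < 1 - a := by linarith
  have h1b : 0 < 1 - b := by linarith
  have hcp : c * p = p - 1 := by
    rw [hc]
    field_simp
  have hexp : ∀ u, 0 < 1 - u →
      p * (1 / (1 - u) - 1) / (1 / (1 - u) * (p - 1)) = u / c := by
    intro u hu
    rw [← hcp]
    field_simp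
    ring
  refine ⟨1 / (1 - a), 1 / (1 - b), ?_, ?_, ?_, ?_⟩
  · rw [le_div_iff₀ h1a]
    linarith
  · rw [le_div_iff₀ h1b]
    linarith
  · rw [one_div_one_div, one_div_one_div]
    linarith
  rw [hexp a h1a, hexp b h1b]
  have hC : youngC p (1 / (1 - a)) (1 / (1 - b)) =
      exp ((a * log a - (1 - a) * log (1 - a)) + (b * log b - (1 - b) * log (1 - b))
        - (c * log c - (1 - c) * log (1 - c))) := by
    rw [youngC, youngA_one_div_one_sub ha (by linarith), youngA_one_div_one_sub hb (by linarith),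
      hpc, youngA_one_div_one_sub hc0 hc1, ← exp_add, ← exp_sub]
  have hα' : -(α * p) / (p - 1) = -((2 - c) / (2 * (1 - c))) / c := by
    rw [← hcp, hα, hpc]
    field_simp
    ring
  have key := log_defect_le hc0 hc1 (div_pos ha hc0) (div_pos hb hc0)
    (by rw [← add_div, hab, div_self hc0.ne'])
  rw [mul_div_cancel₀ _ hc0.ne', mul_div_cancel₀ _ hc0.ne', log_div ha.ne' hc0.ne',
    log_div hb.ne' hc0.ne'] at key
  have hrhs : c ^ 2 * (-(a / c * (log a - log c)) - b / c * (log b - log c))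
      = c * (c * log c - a * log a - b * log b) := by
    obtain rfl : b = c - a := by linarith
    field_simp
    ring
  rw [hrhs] at key
  rw [hC, hα', ← exp_mul, rpow_def_of_pos ha, rpow_def_of_pos hb, ← exp_add, ← exp_add, ge_iff_le,
    ← log_le_iff_le_exp hc0, ← sub_nonneg]
  have hdiff : ∀ A B C D E F : ℝ, ((A - B) + (D - E) - (C - F)) *
      (-((2 - c) / (2 * (1 - c))) / c) + A / c + D / c - C / c =
      (c * (C - A - D) - (2 - c) * (F - B - E)) / (2 * (1 - c) * c) := by
    intro A B C D E F
    field_simp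
    ring
  have := hdiff (a * log a) ((1 - a) * log (1 - a)) (c * log c) (b * log b)
    ((1 - b) * log (1 - b)) ((1 - c) * log (1 - c))
  calc (0 : ℝ) ≤ _ := div_nonneg (sub_nonneg.2 key) (by positivity)
    _ = _ := this.symm
    _ = _ := by
      rw [mul_div_cancel_left₀ _ hc0.ne']
      ring
end
end

section
/- (Linear form of the entropy power inequality) Let d ≥ 1 and t ∈ (0,1). For any two probability density functions f, g on ℝ^d with finite differential entropies such that the weighted-sum density h_t (the density of √t·X + √(1-t)·Y for independent X ~ f, Y ~ g) has well-defined differential entropy, H(h_t) ≥ t·H(f) + (1-t)·H(g). -/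
open MeasureTheory Real

noncomputable section

open Set Filter Topology ProbabilityTheory

/-- `f` takes values in `[exp (-L), exp L]` on the closed ball of radius `R` and vanishes
outside. -/
structure IsTame {E : Type*} [NormedAddCommGroup E] [MeasurableSpace E] (R L : ℝ) (f : E → ℝ) :
    Prop where
  measurable : Measurable f
  exp_neg_le : ∀ x, ‖x‖ ≤ R → exp (-L) ≤ f x
  le_exp : ∀ x, ‖x‖ ≤ R → f x ≤ exp L
  eq_zero : ∀ x, R < ‖x‖ → f x = 0

namespace IsTame

variable {E : Type*} [NormedAddCommGroup E] [MeasurableSpace E] {R L : ℝ} {f : E → ℝ}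

lemma pos (hf : IsTame R L f) {x : E} (hx : ‖x‖ ≤ R) : 0 < f x :=
  (exp_pos _).trans_le (hf.exp_neg_le x hx)

lemma nonneg (hf : IsTame R L f) (x : E) : 0 ≤ f x := by
  rcases le_or_gt ‖x‖ R with hx | hx
  · exact (hf.pos hx).le
  · exact (hf.eq_zero x hx).ge

lemma le (hf : IsTame R L f) (x : E) : f x ≤ exp L := by
  rcases le_or_gt ‖x‖ R with hx | hx
  · exact hf.le_exp x hx
  · exact (hf.eq_zero x hx).le.trans (exp_pos _).le

lemma abs_log_le (hf : IsTame R L f) (hL : 0 ≤ L) (x : E) : |log (f x)| ≤ L := by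
  rcases le_or_gt ‖x‖ R with hx | hx
  · rw [abs_le]
    exact ⟨(le_log_iff_exp_le (hf.pos hx)).2 (hf.exp_neg_le x hx),
      (log_le_iff_le_exp (hf.pos hx)).2 (hf.le_exp x hx)⟩
  · simp [hf.eq_zero x hx, hL]

lemma mono (hf : IsTame R L f) {L' : ℝ} (h : L ≤ L') : IsTame R L' f where
  measurable := hf.measurable
  exp_neg_le x hx := (exp_le_exp.2 (by linarith)).trans (hf.exp_neg_le x hx)
  le_exp x hx := (hf.le_exp x hx).trans (exp_le_exp.2 h)
  eq_zero := hf.eq_zero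

variable [NormedSpace ℝ E] [FiniteDimensional ℝ E]
  {μ : Measure E} [IsFiniteMeasureOnCompacts μ]

lemma integrable (hf : IsTame R L f) : Integrable f μ := by
  have hs : Function.support f ⊆ Metric.closedBall 0 R := by
    intro x hx
    by_contra h
    exact hx (hf.eq_zero x (by simpa using h))
  rw [← integrableOn_iff_integrable_of_support_subset hs]
  refine Measure.integrableOn_of_bounded (M := exp L) ?_ hf.measurable.aestronglyMeasurable ?_
  · have := FiniteDimensional.proper_real E
    exact (isCompact_closedBall 0 R).measure_lt_top.ne
  · refine ae_of_all _ fun x => ?_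
    rw [norm_of_nonneg (hf.nonneg x)]
    exact hf.le x

lemma integrable_mul (hf : IsTame R L f) {φ : E → ℝ} (hφ : Measurable φ) {C : ℝ}
    (hC : ∀ x, |φ x| ≤ C) : Integrable (fun x => f x * φ x) μ :=
  hf.integrable.mul_bdd (c := C) hφ.aestronglyMeasurable (ae_of_all _ hC)

lemma integrable_mul_log (hf : IsTame R L f) : Integrable (fun x => f x * log (f x)) μ :=
  (hf.mono (le_abs_self L)).integrable_mul hf.measurable.log
    ((hf.mono (le_abs_self L)).abs_log_le (abs_nonneg L))

end IsTame

lemma gaussianReal_ne_zero_of_volume_ne_zero {s : Set ℝ} (hs : volume s ≠ 0) :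
    gaussianReal 0 1 s ≠ 0 :=
  fun h => hs (gaussianReal_absolutelyContinuous' 0 one_ne_zero h)

lemma strictMono_cdf_gaussianReal : StrictMono (cdf (gaussianReal 0 1)) := by
  intro x y hxy
  rw [cdf_eq_real, cdf_eq_real, ← Iic_union_Ioc_eq_Iic hxy.le,
    measureReal_union (Iic_disjoint_Ioc le_rfl) measurableSet_Ioc]
  have : 0 < (gaussianReal 0 1).real (Ioc x y) :=
    (measureReal_ne_zero_iff).2 (gaussianReal_ne_zero_of_volume_ne_zero (by simp [hxy]))
      |>.lt_of_le' measureReal_nonneg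
  linarith

lemma cdf_gaussianReal_mem_Ioo (x : ℝ) : cdf (gaussianReal 0 1) x ∈ Ioo (0 : ℝ) 1 :=
  ⟨(cdf_nonneg _ (x - 1)).trans_lt (strictMono_cdf_gaussianReal (by linarith)),
    (strictMono_cdf_gaussianReal (lt_add_one x)).trans_le (cdf_le_one _ _)⟩

lemma continuous_gaussianPDFReal : Continuous (gaussianPDFReal 0 1) := by
  unfold gaussianPDFReal
  fun_prop

lemma hasDerivAt_cdf_gaussianReal (x : ℝ) :
    HasDerivAt (cdf (gaussianReal 0 1)) (gaussianPDFReal 0 1 x) x := by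
  have hint := integrable_gaussianPDFReal 0 1
  have h : ∀ y, cdf (gaussianReal 0 1) y =
      cdf (gaussianReal 0 1) x + ∫ u in x..y, gaussianPDFReal 0 1 u := by
    have h0 : ∀ y, cdf (gaussianReal 0 1) y = ∫ u in Iic y, gaussianPDFReal 0 1 u := fun y => by
      rw [cdf_eq_real, measureReal_def, gaussianReal_apply_eq_integral 0 one_ne_zero,
        ENNReal.toReal_ofReal (integral_nonneg fun u => gaussianPDFReal_nonneg 0 1 u)]
    intro y
    rw [h0, h0, ← intervalIntegral.integral_Iic_sub_Iic hint.integrableOn hint.integrableOn]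
    ring
  rw [funext h]
  exact (intervalIntegral.integral_hasDerivAt_right hint.intervalIntegrable
    (continuous_gaussianPDFReal.stronglyMeasurableAtFilter _ _)
    continuous_gaussianPDFReal.continuousAt).const_add _

lemma gaussianReal_setOf_cdf_le {s : ℝ} (hs : s ∈ Icc (0 : ℝ) 1) :
    gaussianReal 0 1 {x | cdf (gaussianReal 0 1) x ≤ s} = ENNReal.ofReal s := by
  have hmem := cdf_gaussianReal_mem_Ioo
  rcases hs.1.eq_or_lt with rfl | h0
  · have : {x | cdf (gaussianReal 0 1) x ≤ 0} = ∅ :=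
      eq_empty_of_forall_notMem fun x hx => absurd (hmem x).1 (not_lt.2 hx)
    simp [this]
  rcases hs.2.eq_or_lt with rfl | h1
  · have : {x | cdf (gaussianReal 0 1) x ≤ 1} = univ :=
      eq_univ_of_forall fun x => (hmem x).2.le
    simp [this]
  have hc : Continuous (cdf (gaussianReal 0 1)) :=
    continuous_iff_continuousAt.2 fun x => (hasDerivAt_cdf_gaussianReal x).continuousAt
  obtain ⟨x, rfl⟩ := mem_range_of_exists_le_of_exists_ge hc
    (((tendsto_cdf_atBot _).eventually_lt_const h0).exists.imp fun _ h => h.le)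
    (((tendsto_cdf_atTop _).eventually_const_lt h1).exists.imp fun _ h => h.le)
  simp_rw [strictMono_cdf_gaussianReal.le_iff_le]
  exact (ofReal_cdf _ x).symm

/-- The increasing rearrangement of a standard Gaussian variable onto a tame density on `ℝ`. -/
lemma exists_gaussian_transport {R L : ℝ} {f : ℝ → ℝ} (hR : 0 < R) (hf : IsTame R L f)
    (hf1 : ∫ x, f x = 1) :
    ∃ T : ℝ → ℝ, StrictMono T ∧ (∀ x, ‖T x‖ ≤ R) ∧
      (gaussianReal 0 1).map T = volume.withDensity (fun x => ENNReal.ofReal (f x)) ∧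
      ∀ᵐ x, HasDerivAt T (gaussianPDFReal 0 1 x / f (T x)) x := by
  have hint : Integrable f := hf.integrable
  have hii : ∀ x y, IntervalIntegrable f volume x y := fun x y => hint.intervalIntegrable
  set F : ℝ → ℝ := fun y => ∫ u in (-R)..y, f u with hF
  have hFc : Continuous F := intervalIntegral.continuous_primitive hii _
  have hF0 : F (-R) = 0 := by simp [hF]
  have hFR : F R = 1 := by
    rw [hF, ← hf1]
    dsimp only
    rw [intervalIntegral.integral_of_le (by linarith), ← integral_Icc_eq_integral_Ioc]
    refine setIntegral_eq_integral_of_forall_compl_eq_zero fun x hx => hf.eq_zero x ?_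
    rw [norm_eq_abs]
    by_contra h
    exact hx (abs_le.1 (not_lt.1 h))
  have hFlow : ∀ x ∈ Icc (-R) R, ∀ y ∈ Icc (-R) R, x ≤ y → exp (-L) * (y - x) ≤ F y - F x := by
    intro x hx y hy hxy
    have : F y - F x = ∫ u in x..y, f u :=
      intervalIntegral.integral_interval_sub_left (hii _ _) (hii _ _)
    rw [this]
    have := intervalIntegral.integral_mono_on hxy (f := fun _ => exp (-L)) (g := f)
      intervalIntegrable_const (hii _ _) fun u hu => hf.exp_neg_le u
        (abs_le.2 ⟨hx.1.trans hu.1, hu.2.trans hy.2⟩)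
    simpa [mul_comm] using this
  have hsurj : ∀ y : ℝ, ∃ x ∈ Icc (-R) R, y ∈ Icc (0 : ℝ) 1 → F x = y := by
    intro y
    by_cases hy : y ∈ Icc (0 : ℝ) 1
    · have := intermediate_value_Icc (by linarith : -R ≤ R) hFc.continuousOn
      rw [hF0, hFR] at this
      obtain ⟨x, hx, rfl⟩ := this hy
      exact ⟨x, hx, fun _ => rfl⟩
    · exact ⟨R, ⟨by linarith, le_rfl⟩, fun h => absurd h hy⟩
  choose G hGmem hFG using hsurj
  have hlip : ∀ y ∈ Icc (0 : ℝ) 1, ∀ z ∈ Icc (0 : ℝ) 1, exp (-L) * |G y - G z| ≤ |y - z| := by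
    intro y hy z hz
    rcases le_total (G y) (G z) with h | h
    · have := hFlow _ (hGmem y) _ (hGmem z) h
      rw [hFG y hy, hFG z hz] at this
      rw [abs_sub_comm, abs_of_nonneg (sub_nonneg.2 h), abs_sub_comm]
      exact this.trans (le_abs_self _)
    · have := hFlow _ (hGmem z) _ (hGmem y) h
      rw [hFG y hy, hFG z hz] at this
      rw [abs_of_nonneg (sub_nonneg.2 h)]
      exact this.trans (le_abs_self _)
  have hGc : ∀ y ∈ Ioo (0 : ℝ) 1, ContinuousAt G y := by
    intro y hy
    rw [Metric.continuousAt_iff]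
    intro ε hε
    obtain ⟨δ, hδ, hball⟩ := Metric.isOpen_iff.1 isOpen_Ioo y hy
    refine ⟨min δ (exp (-L) * ε), lt_min hδ (by positivity), fun z hz => ?_⟩
    have hz1 := hball (Metric.mem_ball.2 (hz.trans_le (min_le_left _ _)))
    have h1 := hlip z (Ioo_subset_Icc_self hz1) y (Ioo_subset_Icc_self hy)
    have h2 := hz.trans_le (min_le_right _ _)
    rw [Real.dist_eq] at h2 ⊢
    exact lt_of_mul_lt_mul_left (h1.trans_lt h2) (exp_pos _).le
  set Φ := cdf (gaussianReal 0 1) with hΦ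
  have hΦmem := cdf_gaussianReal_mem_Ioo
  have hFT : ∀ x, F (G (Φ x)) = Φ x := fun x => hFG _ (Ioo_subset_Icc_self (hΦmem x))
  have hFmono : Monotone F := by
    intro x y hxy
    have : F y - F x = ∫ u in x..y, f u :=
      intervalIntegral.integral_interval_sub_left (hii _ _) (hii _ _)
    have h2 := intervalIntegral.integral_nonneg (μ := volume) hxy fun u _ => hf.nonneg u
    linarith
  have hTmono : StrictMono fun x => G (Φ x) := by
    intro x y hxy
    by_contra h
    have := hFmono (not_lt.1 h)
    rw [hFT, hFT] at this
    exact absurd (strictMono_cdf_gaussianReal hxy) (not_lt.2 this)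
  have hTmeas := hTmono.monotone.measurable
  have hmap : (gaussianReal 0 1).map (fun x => G (Φ x)) =
      volume.withDensity (fun x => ENNReal.ofReal (f x)) := by
    have hFI : ∀ a, ∫ u in Iic a, f u = F a := by
      intro a
      have h0 : ∫ u in Iic (-R), f u = 0 := by
        rw [integral_Iic_eq_integral_Iio]
        refine setIntegral_eq_zero_of_forall_eq_zero fun u hu => hf.eq_zero u ?_
        rw [norm_eq_abs, abs_of_neg (by linarith [mem_Iio.1 hu])]
        linarith [mem_Iio.1 hu]
      rw [← sub_zero (∫ u in Iic a, f u), ← h0]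
      exact intervalIntegral.integral_Iic_sub_Iic hint.integrableOn hint.integrableOn
    refine Measure.ext_of_Iic _ _ fun a => ?_
    have hpre : (fun x => G (Φ x)) ⁻¹' Iic a = {x | Φ x ≤ F a} := by
      ext x
      simp only [mem_preimage, mem_Iic, mem_ofPred_eq]
      refine ⟨fun h => (hFT x).ge.trans (hFmono h), fun h => ?_⟩
      by_contra! hlt
      rcases lt_or_ge a (-R) with ha | ha
      · exact absurd ((hF0 ▸ hFmono ha.le).trans_lt (hΦmem x).1) (not_lt.2 h)
      · have := hFlow a ⟨ha, hlt.le.trans (hGmem _).2⟩ _ (hGmem (Φ x)) hlt.le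
        rw [hFT] at this
        have := mul_pos (exp_pos (-L)) (sub_pos.2 hlt)
        linarith
    rw [Measure.map_apply hTmeas measurableSet_Iic, hpre, withDensity_apply _ measurableSet_Iic,
      ← ofReal_integral_eq_lintegral_ofReal hint.integrableOn (ae_of_all _ hf.nonneg), hFI]
    refine gaussianReal_setOf_cdf_le ⟨?_, ?_⟩
    · rw [← hFI]
      exact integral_nonneg hf.nonneg
    · rw [← hFI, ← hf1]
      exact setIntegral_le_integral hint (ae_of_all _ hf.nonneg)
  refine ⟨fun x => G (Φ x), hTmono, fun x => abs_le.2 (hGmem _), hmap, ?_⟩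
  have hae := LocallyIntegrable.ae_hasDerivAt_integral hint.locallyIntegrable
  have h1 : ∀ᵐ y ∂((gaussianReal 0 1).map (fun x => G (Φ x))), HasDerivAt F (f y) y := by
    rw [hmap]
    filter_upwards [(withDensity_absolutelyContinuous _ _).ae_le hae] with y hy using hy (-R)
  have h2 := (gaussianReal_absolutelyContinuous' 0 one_ne_zero).ae_le
    (ae_of_ae_map hTmeas.aemeasurable h1)
  filter_upwards [h2] with x hx
  have hpos : 0 < f (G (Φ x)) := hf.pos (abs_le.2 (hGmem _))
  have h3 : HasDerivAt G (f (G (Φ x)))⁻¹ (Φ x) := by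
    refine HasDerivAt.of_local_left_inverse (hGc _ (hΦmem x)) hx hpos.ne' ?_
    filter_upwards [isOpen_Ioo.mem_nhds (hΦmem x)] with y hy using hFG y (Ioo_subset_Icc_self hy)
  rw [div_eq_inv_mul]
  exact h3.comp x (hasDerivAt_cdf_gaussianReal x)

lemma ae_comp_mul_add {P : ℝ → Prop} (h : ∀ᵐ x, P x) {a : ℝ} (ha : a ≠ 0) (c : ℝ) :
    ∀ᵐ x, P (a * x + c) := by
  have h1 : ∀ᵐ x, P (x + c) := (measurePreserving_add_right volume c).quasiMeasurePreserving.ae h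
  have h2 : Measure.QuasiMeasurePreserving (fun x : ℝ => a * x) volume volume :=
    ⟨by fun_prop, by
      rw [Real.map_volume_mul_left ha]
      exact Measure.smul_absolutelyContinuous⟩
  exact h2.ae h1

lemma lintegral_comp_mul_deriv_le {S S' k : ℝ → ℝ} (hS : StrictMono S) (hS' : ∀ x, 0 ≤ S' x)
    (hd : ∀ᵐ x, HasDerivAt S (S' x) x) :
    ∫⁻ x, ENNReal.ofReal (S' x * k (S x)) ≤ ∫⁻ x, ENNReal.ofReal (k x) := by
  obtain ⟨N, hN, hNm, hN0⟩ := exists_measurable_superset_of_null (ae_iff.1 hd)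
  have hs : ∀ x ∈ Nᶜ, HasDerivWithinAt S (S' x) Nᶜ x := fun x hx => by
    by_contra h
    exact hx (hN fun h' => h h'.hasDerivWithinAt)
  have key := lintegral_image_eq_lintegral_abs_deriv_mul hNm.compl hs hS.injective.injOn
    (fun x => ENNReal.ofReal (k x))
  have hae : (Nᶜ : Set ℝ) =ᵐ[volume] univ := by
    rw [ae_eq_univ, compl_compl]
    exact hN0
  calc ∫⁻ x, ENNReal.ofReal (S' x * k (S x))
      = ∫⁻ x in Nᶜ, ENNReal.ofReal (S' x * k (S x)) := by
        rw [setLIntegral_congr hae, setLIntegral_univ]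
    _ = ∫⁻ x in S '' Nᶜ, ENNReal.ofReal (k x) := by
        rw [key]
        refine lintegral_congr fun x => ?_
        rw [abs_of_nonneg (hS' x), ENNReal.ofReal_mul (hS' x)]
    _ ≤ _ := setLIntegral_le_lintegral _ _

lemma log_gaussianPDFReal (x : ℝ) :
    log (gaussianPDFReal 0 1 x) = -log (√(2 * π)) - x ^ 2 / 2 := by
  rw [gaussianPDFReal, log_mul (by positivity) (by positivity), log_exp, log_inv]
  simp
  ring

lemma integrable_log_gaussianPDFReal :
    Integrable (fun x => log (gaussianPDFReal 0 1 x)) (gaussianReal 0 1) := by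
  simp_rw [log_gaussianPDFReal]
  have : MemLp id 2 (gaussianReal 0 1) := memLp_id_gaussianReal 2
  exact (integrable_const _).sub (this.integrable_sq.div_const 2)

/-- The product of two standard Gaussian measures is invariant under rotation. -/
lemma measurePreserving_rotation_gaussianReal {t : ℝ} (ht : t ∈ Ioo (0 : ℝ) 1) :
    MeasurePreserving (fun w : ℝ × ℝ => (√t * w.1 - √(1 - t) * w.2, √(1 - t) * w.1 + √t * w.2))
      ((gaussianReal 0 1).prod (gaussianReal 0 1))
      ((gaussianReal 0 1).prod (gaussianReal 0 1)) := by
  refine ⟨by fun_prop, ?_⟩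
  have h := IsGaussian.map_rotation_eq_self_of_forall_strongDual_eq_zero (μ := gaussianReal 0 1)
    (fun L => by
      rw [ContinuousLinearMap.integral_comp_id_comm]
      · simp
      · exact IsGaussian.integrable_id) (-arccos √t)
  have hc : cos (-arccos √t) = √t := by
    rw [cos_neg, cos_arccos (by linarith [sqrt_nonneg t]) (sqrt_le_one.2 ht.2.le)]
  have hs : sin (-arccos √t) = -√(1 - t) := by
    rw [sin_neg, sin_arccos, sq_sqrt ht.1.le]
  convert h using 2
  ext w <;> simp [ContinuousLinearMap.rotation_apply, hc, hs, sub_eq_add_neg]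

lemma integral_withDensity_ofReal {E : Type*} [MeasurableSpace E] {μ : Measure E} {f : E → ℝ}
    (hf : Measurable f) (hf0 : ∀ x, 0 ≤ f x) (φ : E → ℝ) :
    ∫ x, φ x ∂(μ.withDensity fun x => ENNReal.ofReal (f x)) = ∫ x, f x * φ x ∂μ := by
  rw [integral_withDensity_eq_integral_toReal_smul hf.ennreal_ofReal
    (ae_of_all _ fun x => ENNReal.ofReal_lt_top)]
  simp [ENNReal.toReal_ofReal (hf0 _)]

/-- The Gibbs form of the linear entropy power inequality for tame probability densities on `ℝ`. -/
lemma integral_log_le_of_integral_eq_one {t : ℝ} (ht : t ∈ Ioo (0 : ℝ) 1) {R L : ℝ} (hR : 0 < R)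
    (hL : 0 ≤ L) {f g k : ℝ → ℝ} (hf : IsTame R L f) (hg : IsTame R L g)
    (hk : IsTame (2 * R) L k) (hf1 : ∫ x, f x = 1) (hg1 : ∫ x, g x = 1) (hk1 : ∫ x, k x = 1) :
    ∫ x, f x * ∫ y, g y * log (k (√t * x + √(1 - t) * y)) ≤
      t * (∫ x, f x * log (f x)) + (1 - t) * ∫ x, g x * log (g x) := by
  obtain ⟨T, hTm, hTR, hTmap, hTd⟩ := exists_gaussian_transport hR hf hf1
  obtain ⟨U, hUm, hUR, hUmap, hUd⟩ := exists_gaussian_transport hR hg hg1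
  set γ := gaussianReal 0 1 with hγ
  set pdf := gaussianPDFReal 0 1 with hpdf
  have ht0 : 0 < t := ht.1
  have ht1 : 0 < 1 - t := sub_pos.2 ht.2
  set a := √t with ha
  set b := √(1 - t) with hb
  have ha0 : 0 < a := sqrt_pos.2 ht0
  have hb0 : 0 < b := sqrt_pos.2 ht1
  have haa : a * a = t := mul_self_sqrt ht0.le
  have hbb : b * b = 1 - t := mul_self_sqrt ht1.le
  have ha1 : a ≤ 1 := sqrt_le_one.2 ht.2.le
  have hb1 : b ≤ 1 := sqrt_le_one.2 (by linarith)
  have hTmeas : Measurable T := hTm.monotone.measurable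
  have hUmeas : Measurable U := hUm.monotone.measurable
  have hfm := hf.measurable
  have hgm := hg.measurable
  have hkm := hk.measurable
  have hpdfm : Measurable pdf := measurable_gaussianPDFReal 0 1
  have hpdf0 : ∀ x, 0 < pdf x := fun x => gaussianPDFReal_pos 0 1 x one_ne_zero
  have hfT : ∀ x, 0 < f (T x) := fun x => hf.pos (hTR x)
  have hgU : ∀ x, 0 < g (U x) := fun x => hg.pos (hUR x)
  set rot : ℝ × ℝ → ℝ × ℝ := fun w => (a * w.1 - b * w.2, b * w.1 + a * w.2) with hrot_def
  have hrot : MeasurePreserving rot (γ.prod γ) (γ.prod γ) :=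
    measurePreserving_rotation_gaussianReal ht
  have hrotm := hrot.measurable
  have int_rot : ∀ φ : ℝ × ℝ → ℝ, Measurable φ →
      ∫ w, φ (rot w) ∂(γ.prod γ) = ∫ w, φ w ∂(γ.prod γ) := fun φ hφ => by
    conv_rhs => rw [← hrot.map_eq]
    rw [integral_map hrot.measurable.aemeasurable hφ.aestronglyMeasurable]
  -- the integral transported to the Gaussian side
  have hlk : Measurable fun w : ℝ × ℝ => log (k (a * T w.1 + b * U w.2)) := by fun_prop
  have hlki : Integrable (fun w : ℝ × ℝ => log (k (a * T w.1 + b * U w.2))) (γ.prod γ) :=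
    Integrable.of_bound hlk.aestronglyMeasurable L (ae_of_all _ fun w => hk.abs_log_le hL _)
  have hLHS : ∫ x, f x * ∫ y, g y * log (k (a * x + b * y)) =
      ∫ w, log (k (a * T w.1 + b * U w.2)) ∂(γ.prod γ) := by
    rw [integral_prod _ hlki, ← integral_withDensity_ofReal hfm hf.nonneg, ← hTmap, integral_map
      hTmeas.aemeasurable]
    · refine integral_congr_ae (ae_of_all _ fun x => ?_)
      dsimp only
      rw [← integral_withDensity_ofReal hgm hg.nonneg, ← hUmap, integral_map
        hUmeas.aemeasurable (Measurable.aestronglyMeasurable (by fun_prop))]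
    · have : Measurable fun p : ℝ × ℝ => g p.2 * log (k (a * p.1 + b * p.2)) := by fun_prop
      exact this.stronglyMeasurable.integral_prod_right.aestronglyMeasurable
  -- the logarithm of the derivatives of the transport maps
  have hlogi : ∀ {q : ℝ → ℝ} {V : ℝ → ℝ}, IsTame R L q → Measurable V →
      Integrable (fun x => log (pdf x) - log (q (V x))) γ := fun {q V} hq hV =>
    integrable_log_gaussianPDFReal.sub (Integrable.of_bound
      (hq.measurable.comp hV).log.aestronglyMeasurable L (ae_of_all _ fun w => hq.abs_log_le hL _))
  have hlog : ∀ {q : ℝ → ℝ} {V : ℝ → ℝ}, IsTame R L q → Measurable V →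
      γ.map V = volume.withDensity (fun x => ENNReal.ofReal (q x)) →
      ∫ x, (log (pdf x) - log (q (V x))) ∂γ = ∫ x, log (pdf x) ∂γ - ∫ x, q x * log (q x) := by
    intro q V hq hV hmap
    have hqi : Integrable (fun x => log (q (V x))) γ := Integrable.of_bound
      (hq.measurable.comp hV).log.aestronglyMeasurable L (ae_of_all _ fun w => hq.abs_log_le hL _)
    rw [integral_sub integrable_log_gaussianPDFReal hqi,
      ← integral_withDensity_ofReal hq.measurable hq.nonneg, ← hmap, integral_map hV.aemeasurable
      hq.measurable.log.aestronglyMeasurable]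
  -- the derivative of the rotated transport map
  set D : ℝ × ℝ → ℝ := fun w => t * (pdf w.1 / f (T w.1)) + (1 - t) * (pdf w.2 / g (U w.2)) with hD
  have hDm : Measurable D := by fun_prop
  have hD0 : ∀ w, 0 < D w := fun w => by
    have := hpdf0 w.1; have := hpdf0 w.2; have := hfT w.1; have := hgU w.2
    simp only [hD]
    positivity
  set S : ℝ × ℝ → ℝ := fun w => a * T w.1 + b * U w.2 with hS
  have hSm : Measurable S := by fun_prop
  have hslice : ∀ v, ∫⁻ u, ENNReal.ofReal (D (rot (u, v)) * k (S (rot (u, v)))) ≤ 1 := by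
    intro v
    have h1 : ∫⁻ x, ENNReal.ofReal (k x) = 1 := by
      rw [← ofReal_integral_eq_lintegral_ofReal hk.integrable (ae_of_all _ hk.nonneg), hk1,
        ENNReal.ofReal_one]
    rw [← h1]
    refine lintegral_comp_mul_deriv_le (S := fun u => S (rot (u, v)))
      (S' := fun u => D (rot (u, v))) (fun u u' h => ?_) (fun u => (hD0 _).le) ?_
    · simp only [hS, hrot_def]
      gcongr
      · exact hTm (by gcongr)
      · exact hUm (by gcongr)
    · filter_upwards [ae_comp_mul_add hTd ha0.ne' (-(b * v)),
        ae_comp_mul_add hUd hb0.ne' (a * v)] with u hu1 hu2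
      have e1 : HasDerivAt (fun u => a * u - b * v) a u := by
        simpa using ((hasDerivAt_id u).const_mul a).sub_const (b * v)
      have e2 : HasDerivAt (fun u => b * u + a * v) b u := by
        simpa using ((hasDerivAt_id u).const_mul b).add_const (a * v)
      rw [← sub_eq_add_neg] at hu1
      have := ((hu1.comp u e1).const_mul a).add ((hu2.comp u e2).const_mul b)
      convert! this using 1
      simp only [hD, hrot_def]
      rw [← hbb, ← haa]
      ring
  set Q : ℝ × ℝ → ℝ := fun w => D (rot w) * k (S (rot w)) / pdf w.1 with hQ
  have hQm : Measurable Q := by fun_prop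
  have hQ0 : ∀ w, 0 ≤ Q w := fun w =>
    div_nonneg (mul_nonneg (hD0 _).le (hk.nonneg _)) (hpdf0 _).le
  have hQl : ∫⁻ w, ENNReal.ofReal (Q w) ∂(γ.prod γ) ≤ 1 := by
    rw [lintegral_prod_symm _ hQm.ennreal_ofReal.aemeasurable]
    calc ∫⁻ v, ∫⁻ u, ENNReal.ofReal (Q (u, v)) ∂γ ∂γ ≤ ∫⁻ _, 1 ∂γ := by
          refine lintegral_mono fun v => ?_
          rw [hγ, gaussianReal_of_var_ne_zero 0 one_ne_zero,
            lintegral_withDensity_eq_lintegral_mul _ (measurable_gaussianPDF 0 1) (by fun_prop)]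
          refine le_of_eq_of_le (lintegral_congr fun u => ?_) (hslice v)
          simp only [Pi.mul_apply, gaussianPDF, hQ]
          rw [← ENNReal.ofReal_mul (hpdf0 u).le, mul_div_cancel₀ _ (hpdf0 u).ne']
      _ = 1 := by simp
  have hQi : Integrable Q (γ.prod γ) :=
    ⟨hQm.aestronglyMeasurable, by
      rw [hasFiniteIntegral_iff_ofReal (ae_of_all _ hQ0)]
      exact hQl.trans_lt ENNReal.one_lt_top⟩
  have hQ1 : ∫ w, Q w ∂(γ.prod γ) ≤ 1 := by
    rw [integral_eq_lintegral_of_nonneg_ae (ae_of_all _ hQ0) hQm.aestronglyMeasurable]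
    exact ENNReal.toReal_le_of_le_ofReal zero_le_one (by simpa using hQl)
  -- the pointwise inequality
  have hpt : ∀ w, log (k (S (rot w))) + (t * (log (pdf (rot w).1) - log (f (T (rot w).1))) +
      (1 - t) * (log (pdf (rot w).2) - log (g (U (rot w).2)))) - log (pdf w.1) ≤ Q w - 1 := by
    intro w
    have hSk : 0 < k (S (rot w)) := hk.pos <| by
      have h1 := abs_le.1 (hTR (rot w).1)
      have h2 := abs_le.1 (hUR (rot w).2)
      simp only [hS, norm_eq_abs]
      rw [abs_le]
      constructor <;> nlinarith
    have hconc : t * (log (pdf (rot w).1) - log (f (T (rot w).1))) +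
        (1 - t) * (log (pdf (rot w).2) - log (g (U (rot w).2))) ≤ log (D (rot w)) := by
      rw [← log_div (hpdf0 _).ne' (hfT _).ne', ← log_div (hpdf0 _).ne' (hgU _).ne']
      exact strictConcaveOn_log_Ioi.concaveOn.2 (div_pos (hpdf0 _) (hfT _))
        (div_pos (hpdf0 _) (hgU _)) ht0.le ht1.le (by ring)
    have hlogQ : log (Q w) = log (D (rot w)) + log (k (S (rot w))) - log (pdf w.1) := by
      rw [hQ, log_div (mul_pos (hD0 _) hSk).ne' (hpdf0 _).ne', log_mul (hD0 _).ne' hSk.ne']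
    have := log_le_sub_one_of_pos (show 0 < Q w from div_pos (mul_pos (hD0 _) hSk) (hpdf0 _))
    linarith
  have hi1 : Integrable (fun w => log (k (S (rot w)))) (γ.prod γ) :=
    hrot.integrable_comp_of_integrable hlki
  have hif : Integrable (fun w : ℝ × ℝ => log (pdf w.1) - log (f (T w.1))) (γ.prod γ) :=
    (hlogi hf hTmeas).comp_fst γ
  have hig : Integrable (fun w : ℝ × ℝ => log (pdf w.2) - log (g (U w.2))) (γ.prod γ) :=
    (hlogi hg hUmeas).comp_snd γ
  have hi2 := (hrot.integrable_comp_of_integrable hif).const_mul t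
  have hi3 := (hrot.integrable_comp_of_integrable hig).const_mul (1 - t)
  have hi4 : Integrable (fun w : ℝ × ℝ => log (pdf w.1)) (γ.prod γ) :=
    integrable_log_gaussianPDFReal.comp_fst γ
  have hmain := integral_mono ((hi1.add (hi2.add hi3)).sub hi4) (hQi.sub (integrable_const 1)) hpt
  rw [integral_sub' (hi1.add (hi2.add hi3)) hi4, integral_add' hi1 (hi2.add hi3),
    integral_add' hi2 hi3, integral_sub' hQi (integrable_const 1), integral_const_mul,
    integral_const_mul] at hmain
  have e1 : ∫ w, log (k (S (rot w))) ∂(γ.prod γ) = ∫ w, log (k (S w)) ∂(γ.prod γ) :=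
    int_rot _ hlk
  have e2 : ∫ w, ((fun w : ℝ × ℝ => log (pdf w.1) - log (f (T w.1))) ∘ rot) w ∂(γ.prod γ) =
      ∫ x, log (pdf x) ∂γ - ∫ x, f x * log (f x) := by
    rw [← hlog hf hTmeas hTmap]
    refine (int_rot (fun w => log (pdf w.1) - log (f (T w.1))) (by fun_prop)).trans ?_
    simpa using integral_fun_fst (μ := γ) (ν := γ) (fun x => log (pdf x) - log (f (T x)))
  have e3 : ∫ w, ((fun w : ℝ × ℝ => log (pdf w.2) - log (g (U w.2))) ∘ rot) w ∂(γ.prod γ) =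
      ∫ x, log (pdf x) ∂γ - ∫ x, g x * log (g x) := by
    rw [← hlog hg hUmeas hUmap]
    refine (int_rot (fun w => log (pdf w.2) - log (g (U w.2))) (by fun_prop)).trans ?_
    simpa using integral_fun_snd (μ := γ) (ν := γ) (fun x => log (pdf x) - log (g (U x)))
  have e4 : ∫ w : ℝ × ℝ, log (pdf w.1) ∂(γ.prod γ) = ∫ x, log (pdf x) ∂γ := by
    simpa using integral_fun_fst (μ := γ) (ν := γ) (fun x => log (pdf x))
  rw [e1, e2, e3, e4] at hmain
  rw [hLHS]
  simp only [integral_const, probReal_univ, smul_eq_mul] at hmain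
  simp only [hS] at hmain
  linarith

/-- The Gibbs form of the linear entropy power inequality for tame functions on `E`, which need not
be normalised. -/
def GibbsInequality (t : ℝ) (E : Type*) [NormedAddCommGroup E] [NormedSpace ℝ E]
    [MeasureSpace E] : Prop :=
  ∀ (R L : ℝ) (f g k : E → ℝ), 0 < R → 0 ≤ L → IsTame R L f → IsTame R L g →
    IsTame (2 * R) L k →
    ∫ x, f x * ∫ y, g y * log (k (√t • x + √(1 - t) • y)) ≤
      t * (∫ y, g y) * (∫ x, f x * log (f x)) + (1 - t) * (∫ x, f x) * (∫ y, g y * log (g y)) -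
      (∫ x, f x) * (∫ y, g y) *
        (t * log (∫ x, f x) + (1 - t) * log (∫ y, g y) - log (∫ z, k z))

namespace IsTame

variable {E : Type*} [NormedAddCommGroup E] [MeasurableSpace E] {R L : ℝ} {f : E → ℝ}

lemma const_mul (hf : IsTame R L f) {c : ℝ} (hc : 0 < c) :
    IsTame R (L + |log c|) (fun x => c * f x) where
  measurable := hf.measurable.const_mul c
  exp_neg_le x hx := by
    rw [neg_add, add_comm, exp_add]
    have : exp (-|log c|) ≤ c := by
      conv_rhs => rw [← exp_log hc]
      exact exp_le_exp.2 (neg_abs_le _)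
    exact mul_le_mul this (hf.exp_neg_le x hx) (exp_pos _).le hc.le
  le_exp x hx := by
    rw [add_comm, exp_add]
    have : c ≤ exp |log c| := by
      conv_lhs => rw [← exp_log hc]
      exact exp_le_exp.2 (le_abs_self _)
    exact mul_le_mul this (hf.le_exp x hx) (hf.nonneg x) (exp_pos _).le
  eq_zero x hx := by simp [hf.eq_zero x hx]

lemma integral_pos [NormedSpace ℝ E] [FiniteDimensional ℝ E] [BorelSpace E]
    {μ : Measure E} [IsFiniteMeasureOnCompacts μ] [μ.IsOpenPosMeasure]
    (hf : IsTame R L f) (hR : 0 < R) : 0 < ∫ x, f x ∂μ := by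
  rw [integral_pos_iff_support_of_nonneg hf.nonneg hf.integrable]
  refine (Metric.measure_ball_pos μ (0 : E) hR).trans_le (measure_mono fun x hx => ?_)
  exact (hf.pos (by simpa using (Metric.mem_ball.1 hx).le)).ne'

end IsTame

lemma integral_mul_log_const_mul {E : Type*} [MeasurableSpace E] {μ : Measure E} {f : E → ℝ}
    {c : ℝ} (hc : c ≠ 0) (hf : Integrable f μ) (hfl : Integrable (fun x => f x * log (f x)) μ) :
    ∫ x, c * f x * log (c * f x) ∂μ =
      c * ∫ x, f x * log (f x) ∂μ + c * log c * ∫ x, f x ∂μ := by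
  rw [← integral_const_mul, ← integral_const_mul, ← integral_add (hfl.const_mul _)
    (hf.const_mul _)]
  refine integral_congr_ae (ae_of_all _ fun x => ?_)
  by_cases h : f x = 0
  · simp [h]
  · simp only [log_mul hc h]
    ring

lemma gibbsInequality_real {t : ℝ} (ht : t ∈ Ioo (0 : ℝ) 1) : GibbsInequality t ℝ := by
  intro R L f g k hR hL hf hg hk
  have hm := hf.integral_pos (μ := volume) hR
  have hn := hg.integral_pos (μ := volume) hR
  have hκ := hk.integral_pos (μ := volume) (by positivity)
  set m := ∫ x, f x with hm_def
  set n := ∫ x, g x with hn_def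
  set κ := ∫ x, k x with hκ_def
  set L' := L + |log m⁻¹| + |log n⁻¹| + |log κ⁻¹|
  have hf' : IsTame R L' (fun x => m⁻¹ * f x) := (hf.const_mul (inv_pos.2 hm)).mono
    (by simp only [L']; linarith [abs_nonneg (log n⁻¹), abs_nonneg (log κ⁻¹)])
  have hg' : IsTame R L' (fun x => n⁻¹ * g x) := (hg.const_mul (inv_pos.2 hn)).mono
    (by simp only [L']; linarith [abs_nonneg (log m⁻¹), abs_nonneg (log κ⁻¹)])
  have hk' : IsTame (2 * R) L' (fun x => κ⁻¹ * k x) := (hk.const_mul (inv_pos.2 hκ)).mono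
    (by simp only [L']; linarith [abs_nonneg (log n⁻¹), abs_nonneg (log m⁻¹)])
  have key := integral_log_le_of_integral_eq_one ht hR (by positivity) hf' hg' hk'
    (by rw [integral_const_mul, ← hm_def, inv_mul_cancel₀ hm.ne'])
    (by rw [integral_const_mul, ← hn_def, inv_mul_cancel₀ hn.ne'])
    (by rw [integral_const_mul, ← hκ_def, inv_mul_cancel₀ hκ.ne'])
  rw [integral_mul_log_const_mul (inv_ne_zero hm.ne') hf.integrable hf.integrable_mul_log,
    integral_mul_log_const_mul (inv_ne_zero hn.ne') hg.integrable hg.integrable_mul_log,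
    ← hm_def, ← hn_def] at key
  have hkm := hk.measurable
  have ha1 : √t ≤ 1 := sqrt_le_one.2 ht.2.le
  have hb1 : √(1 - t) ≤ 1 := sqrt_le_one.2 (by linarith [ht.1])
  have hinner : ∀ x, ‖x‖ ≤ R → ∫ y, n⁻¹ * g y * log (κ⁻¹ * k (√t * x + √(1 - t) * y)) =
      n⁻¹ * (∫ y, g y * log (k (√t * x + √(1 - t) * y))) - log κ := by
    intro x hx
    have hi : Integrable (fun y => g y * log (k (√t * x + √(1 - t) * y))) :=
      hg.integrable_mul (by fun_prop) fun y => hk.abs_log_le hL _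
    calc _ = ∫ y, (n⁻¹ * (g y * log (k (√t * x + √(1 - t) * y))) - (n⁻¹ * log κ) * g y) := by
          refine integral_congr_ae (ae_of_all _ fun y => ?_)
          rcases le_or_gt ‖y‖ R with hy | hy
          · have hpos : 0 < k (√t * x + √(1 - t) * y) := hk.pos <| by
              have h1 := abs_le.1 hx
              have h2 := abs_le.1 hy
              have h3 := sqrt_nonneg t
              have h4 := sqrt_nonneg (1 - t)
              rw [norm_eq_abs, abs_le]
              constructor <;> nlinarith
            simp only [log_mul (inv_ne_zero hκ.ne') hpos.ne', log_inv]
            ring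
          · simp [hg.eq_zero y hy]
      _ = _ := by
          rw [integral_sub (hi.const_mul _) (hg.integrable.const_mul _), integral_const_mul,
            integral_const_mul, ← hn_def]
          field_simp
  have houter : ∫ x, m⁻¹ * f x * ∫ y, n⁻¹ * g y * log (κ⁻¹ * k (√t * x + √(1 - t) * y)) =
      m⁻¹ * n⁻¹ * (∫ x, f x * ∫ y, g y * log (k (√t * x + √(1 - t) * y))) - log κ := by
    have hi : Integrable (fun x => f x * ∫ y, g y * log (k (√t * x + √(1 - t) * y))) := by
      refine hf.integrable_mul (C := n * L) ?_ fun x => ?_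
      · have : Measurable fun p : ℝ × ℝ => g p.2 * log (k (√t * p.1 + √(1 - t) * p.2)) := by
          have := hg.measurable
          fun_prop
        exact this.stronglyMeasurable.integral_prod_right'.measurable
      · rw [hn_def, ← integral_mul_const, ← norm_eq_abs]
        refine norm_integral_le_of_norm_le ((hg.integrable (μ := volume)).mul_const L)
          (ae_of_all _ fun y => ?_)
        rw [norm_mul, norm_of_nonneg (hg.nonneg y)]
        exact mul_le_mul_of_nonneg_left (hk.abs_log_le hL _) (hg.nonneg y)
    calc _ = ∫ x, (m⁻¹ * n⁻¹ * (f x * ∫ y, g y * log (k (√t * x + √(1 - t) * y))) -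
          (m⁻¹ * log κ) * f x) := by
          refine integral_congr_ae (ae_of_all _ fun x => ?_)
          rcases le_or_gt ‖x‖ R with hx | hx
          · simp only [hinner x hx]
            ring
          · simp [hf.eq_zero x hx]
      _ = _ := by
          rw [integral_sub (hi.const_mul _) (hf.integrable.const_mul _), integral_const_mul,
            integral_const_mul, ← hm_def]
          field_simp
  rw [houter] at key
  simp only [smul_eq_mul]
  rw [log_inv, log_inv] at key
  have hmn : 0 < m * n := by positivity
  have key2 := mul_le_mul_of_nonneg_left key hmn.le
  have e1 : m * n * (m⁻¹ * n⁻¹ * (∫ x, f x * ∫ y, g y * log (k (√t * x + √(1 - t) * y))) - log κ) =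
      (∫ x, f x * ∫ y, g y * log (k (√t * x + √(1 - t) * y))) - m * n * log κ := by
    field_simp
  rw [e1] at key2
  have e2 : ∀ A B : ℝ, m * n * (t * (m⁻¹ * A + m⁻¹ * -log m * m) +
      (1 - t) * (n⁻¹ * B + n⁻¹ * -log n * n)) =
      t * n * A + (1 - t) * m * B - m * n * (t * log m + (1 - t) * log n) := by
    intro A B
    field_simp
    ring
  rw [e2] at key2
  linarith

namespace IsTame

variable {E : Type*} [NormedAddCommGroup E] [MeasurableSpace E] {R L : ℝ} {f : ℝ × E → ℝ}

lemma slice (hf : IsTame R L f) {x : E} (hx : ‖x‖ ≤ R) : IsTame R L (fun s => f (s, x)) where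
  measurable := hf.measurable.comp (by fun_prop)
  exp_neg_le s hs := hf.exp_neg_le (s, x) (max_le hs hx)
  le_exp s hs := hf.le_exp (s, x) (max_le hs hx)
  eq_zero s hs := hf.eq_zero (s, x) (hs.trans_le (le_max_left _ _))

lemma slice_eq_zero (hf : IsTame R L f) {x : E} (hx : R < ‖x‖) (s : ℝ) : f (s, x) = 0 :=
  hf.eq_zero (s, x) (hx.trans_le (le_max_right _ _))

lemma marginal (hf : IsTame R L f) (hR : 0 < R) :
    IsTame R (L + |log (2 * R)|) (fun x => ∫ s, f (s, x)) := by
  have h2R : 0 < 2 * R := by positivity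
  have hind : ∀ c : ℝ, ∫ s, (Icc (-R) R).indicator (fun _ => c) s = 2 * R * c := fun c => by
    rw [integral_indicator measurableSet_Icc, setIntegral_const, smul_eq_mul,
      Real.volume_real_Icc_of_le (by linarith)]
    ring
  have hint : ∀ c : ℝ, Integrable ((Icc (-R) R).indicator (fun _ : ℝ => c)) := fun c =>
    (integrable_indicator_iff measurableSet_Icc).2 (by simp)
  have hmem : ∀ s : ℝ, s ∈ Icc (-R) R ↔ ‖s‖ ≤ R := fun s => by
    rw [norm_eq_abs, abs_le, mem_Icc]
  refine ⟨?_, fun x hx => ?_, fun x hx => ?_, fun x hx => ?_⟩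
  · exact hf.measurable.stronglyMeasurable.integral_prod_left'.measurable
  · have h1 : 2 * R * exp (-L) ≤ ∫ s, f (s, x) := by
      rw [← hind]
      refine integral_mono (hint _) (hf.slice hx).integrable fun s => ?_
      by_cases hs : s ∈ Icc (-R) R
      · simpa [hs] using (hf.slice hx).exp_neg_le s ((hmem s).1 hs)
      · simpa [hs] using hf.nonneg (s, x)
    refine le_trans ?_ h1
    rw [neg_add, add_comm, exp_add]
    gcongr
    conv_rhs => rw [← exp_log h2R]
    exact exp_le_exp.2 (neg_abs_le _)
  · have h1 : ∫ s, f (s, x) ≤ 2 * R * exp L := by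
      rw [← hind]
      refine integral_mono (hf.slice hx).integrable (hint _) fun s => ?_
      by_cases hs : s ∈ Icc (-R) R
      · simpa [hs] using (hf.slice hx).le_exp s ((hmem s).1 hs)
      · simpa [hs] using ((hf.slice hx).eq_zero s (not_le.1 fun h => hs ((hmem s).2 h))).le
    refine h1.trans ?_
    rw [add_comm, exp_add]
    gcongr
    conv_lhs => rw [← exp_log h2R]
    exact exp_le_exp.2 (le_abs_self _)
  · simp [hf.slice_eq_zero hx]

end IsTame

lemma norm_sqrt_smul_add_le {E : Type*} [NormedAddCommGroup E] [NormedSpace ℝ E] {t R : ℝ}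
    (ht : t ∈ Ioo (0 : ℝ) 1) {x y : E} (hx : ‖x‖ ≤ R) (hy : ‖y‖ ≤ R) :
    ‖√t • x + √(1 - t) • y‖ ≤ 2 * R := by
  have ha1 : √t ≤ 1 := sqrt_le_one.2 ht.2.le
  have hb1 : √(1 - t) ≤ 1 := sqrt_le_one.2 (by linarith [ht.1])
  have h1 : ‖√t • x‖ ≤ 1 * R := by
    rw [norm_smul, norm_of_nonneg (sqrt_nonneg t)]
    gcongr
  have h2 : ‖√(1 - t) • y‖ ≤ 1 * R := by
    rw [norm_smul, norm_of_nonneg (sqrt_nonneg (1 - t))]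
    gcongr
  linarith [norm_add_le (√t • x) (√(1 - t) • y)]

lemma abs_integral_mul_le {α : Type*} [MeasurableSpace α] {μ : Measure α} {p φ : α → ℝ} {C : ℝ}
    (hp : Integrable p μ) (hp0 : ∀ x, 0 ≤ p x) (hφ : ∀ x, |φ x| ≤ C) :
    |∫ x, p x * φ x ∂μ| ≤ (∫ x, p x ∂μ) * C := by
  rw [← integral_mul_const, ← norm_eq_abs]
  refine norm_integral_le_of_norm_le (hp.mul_const C) (ae_of_all _ fun y => ?_)
  rw [norm_mul, norm_of_nonneg (hp0 y)]
  exact mul_le_mul_of_nonneg_left (hφ y) (hp0 y)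

lemma integrable_prod_of_abs_le_mul {α β : Type*} [MeasurableSpace α] [MeasurableSpace β]
    {μ : Measure α} {ν : Measure β} [SFinite μ] [SFinite ν] {Φ : α × β → ℝ} {p : α → ℝ} {q : β → ℝ}
    (hΦ : Measurable Φ) (hp : Integrable p μ) (hq : Integrable q ν)
    (h : ∀ x y, |Φ (x, y)| ≤ p x * q y) : Integrable Φ (μ.prod ν) :=
  (hp.mul_prod hq).mono' hΦ.aestronglyMeasurable (ae_of_all _ fun z => h z.1 z.2)

lemma gibbsInequality_real_prod {t : ℝ} (ht : t ∈ Ioo (0 : ℝ) 1) {d : ℕ}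
    (ih : GibbsInequality t (Fin d → ℝ)) : GibbsInequality t (ℝ × (Fin d → ℝ)) := by
  intro R L f g k hR hL hf hg hk
  have hfm := hf.measurable
  have hgm := hg.measurable
  have hkm := hk.measurable
  set L' := L + |log (2 * R)| + |log (2 * (2 * R))|
  have hL' : 0 ≤ L' := by positivity
  have hf1 := (hf.marginal hR).mono (L' := L')
    (by simp only [L']; linarith [abs_nonneg (log (2 * (2 * R)))])
  have hg1 := (hg.marginal hR).mono (L' := L')
    (by simp only [L']; linarith [abs_nonneg (log (2 * (2 * R)))])
  have hk1 := (hk.marginal (by positivity)).mono (L' := L')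
    (by simp only [L']; linarith [abs_nonneg (log (2 * R))])
  set f1 : (Fin d → ℝ) → ℝ := fun x => ∫ s, f (s, x) with hf1_def
  set g1 : (Fin d → ℝ) → ℝ := fun x => ∫ s, g (s, x) with hg1_def
  set k1 : (Fin d → ℝ) → ℝ := fun x => ∫ s, k (s, x) with hk1_def
  have hf1m := hf1.measurable
  have hg1m := hg1.measurable
  have hk1m := hk1.measurable
  have hfs : ∀ x, Integrable fun s => f (s, x) := fun x => by
    rcases le_or_gt ‖x‖ R with hx | hx
    · exact (hf.slice hx).integrable
    · simp [hf.slice_eq_zero hx]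
  have hgs : ∀ x, Integrable fun s => g (s, x) := fun x => by
    rcases le_or_gt ‖x‖ R with hx | hx
    · exact (hg.slice hx).integrable
    · simp [hg.slice_eq_zero hx]
  have hIH := ih R L' f1 g1 k1 hR hL' hf1 hg1 hk1
  have hmf : ∫ x, f1 x = ∫ x, f x := (integral_prod_symm _ hf.integrable).symm
  have hmg : ∫ x, g1 x = ∫ x, g x := (integral_prod_symm _ hg.integrable).symm
  have hmk : ∫ x, k1 x = ∫ x, k x := (integral_prod_symm _ hk.integrable).symm
  set J : ℝ × (Fin d → ℝ) → (Fin d → ℝ) → ℝ := fun x y =>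
    ∫ u, g (u, y) * log (k (√t • x + √(1 - t) • (u, y))) with hJ_def
  set A : (Fin d → ℝ) → (Fin d → ℝ) → ℝ := fun x y => ∫ s, f (s, x) * J (s, x) y with hA_def
  have hJm : Measurable fun p : (ℝ × (Fin d → ℝ)) × (Fin d → ℝ) => J p.1 p.2 := by
    have : Measurable fun p : ((ℝ × (Fin d → ℝ)) × (Fin d → ℝ)) × ℝ =>
        g (p.2, p.1.2) * log (k (√t • p.1.1 + √(1 - t) • (p.2, p.1.2))) := by fun_prop
    exact this.stronglyMeasurable.integral_prod_right'.measurable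
  have hJle : ∀ x y, |J x y| ≤ g1 y * L := fun x y =>
    abs_integral_mul_le (hgs y) (fun u => hg.nonneg _) fun u => hk.abs_log_le hL _
  have hAm : Measurable fun p : (Fin d → ℝ) × (Fin d → ℝ) => A p.1 p.2 := by
    have : Measurable fun p : ((Fin d → ℝ) × (Fin d → ℝ)) × ℝ =>
        f (p.2, p.1.1) * J (p.2, p.1.1) p.1.2 := by
      have h2 : Measurable fun p : ((Fin d → ℝ) × (Fin d → ℝ)) × ℝ => J (p.2, p.1.1) p.1.2 :=
        hJm.comp (f := fun p : ((Fin d → ℝ) × (Fin d → ℝ)) × ℝ => ((p.2, p.1.1), p.1.2))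
          (by fun_prop)
      fun_prop
    exact this.stronglyMeasurable.integral_prod_right'.measurable
  have hAle : ∀ x y, |A x y| ≤ f1 x * (g1 y * L) := fun x y =>
    abs_integral_mul_le (hfs x) (fun s => hf.nonneg _) fun s => hJle _ _
  have hAint : Integrable (fun p : (Fin d → ℝ) × (Fin d → ℝ) => A p.1 p.2)
      (volume.prod volume) :=
    integrable_prod_of_abs_le_mul hAm hf1.integrable (hg1.integrable.mul_const L) hAle
  have hlhs : ∫ x, f x * ∫ y, g y * log (k (√t • x + √(1 - t) • y)) =
      ∫ p : (Fin d → ℝ) × (Fin d → ℝ), A p.1 p.2 ∂(volume.prod volume) := by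
    have e1 : ∀ x, ∫ y, g y * log (k (√t • x + √(1 - t) • y)) = ∫ y, J x y := fun x =>
      integral_prod_symm _ (hg.integrable_mul (by fun_prop) fun y => hk.abs_log_le hL _)
    simp_rw [e1]
    have hJi : Measurable fun x => ∫ y, J x y :=
      hJm.stronglyMeasurable.integral_prod_right'.measurable
    have hJl : ∀ x, |∫ y, J x y| ≤ ∫ y, g1 y * L := fun x =>
      norm_integral_le_of_norm_le (f := J x) (hg1.integrable.mul_const L)
        (ae_of_all _ fun y => hJle x y)
    rw [integral_prod _ hAint]
    refine (integral_prod_symm _ (hf.integrable_mul hJi hJl)).trans ?_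
    refine integral_congr_ae (ae_of_all _ fun x => ?_)
    simp only [hA_def, ← integral_const_mul]
    refine integral_integral_swap ?_
    refine integrable_prod_of_abs_le_mul (p := fun s => f (s, x)) (q := fun y => g1 y * L) ?_
      (hfs x) (hg1.integrable.mul_const L) fun s y => ?_
    · have h2 : Measurable fun p : ℝ × (Fin d → ℝ) => J (p.1, x) p.2 :=
        hJm.comp (f := fun p : ℝ × (Fin d → ℝ) => ((p.1, x), p.2)) (by fun_prop)
      simp only [Function.uncurry_def]
      fun_prop
    · simp only [Function.uncurry_def, abs_mul, abs_of_nonneg (hf.nonneg (s, x))]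
      exact mul_le_mul_of_nonneg_left (hJle _ _) (hf.nonneg _)
  set F : (Fin d → ℝ) → ℝ := fun x => ∫ s, f (s, x) * log (f (s, x)) with hF_def
  set G : (Fin d → ℝ) → ℝ := fun y => ∫ s, g (s, y) * log (g (s, y)) with hG_def
  have hFi : Integrable F := (hf.integrable_mul_log (μ := volume.prod volume)).integral_prod_right
  have hGi : Integrable G := (hg.integrable_mul_log (μ := volume.prod volume)).integral_prod_right
  have hF : ∫ x, F x = ∫ x, f x * log (f x) :=
    (integral_prod_symm _ hf.integrable_mul_log).symm
  have hG : ∫ x, G x = ∫ x, g x * log (g x) :=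
    (integral_prod_symm _ hg.integrable_mul_log).symm
  have hpt : ∀ x y, A x y ≤ t * (F x * g1 y) + (1 - t) * (f1 x * G y) -
      (t * (f1 x * log (f1 x) * g1 y) + (1 - t) * (f1 x * (g1 y * log (g1 y)))) +
      f1 x * (g1 y * log (k1 (√t • x + √(1 - t) • y))) := by
    intro x y
    rcases le_or_gt ‖x‖ R with hx | hx
    · rcases le_or_gt ‖y‖ R with hy | hy
      · have := gibbsInequality_real ht R L _ _ _ hR hL (hf.slice hx) (hg.slice hy)
          (hk.slice (norm_sqrt_smul_add_le ht hx hy))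
        refine this.trans (le_of_eq ?_)
        simp only [hF_def, hG_def, hf1_def, hg1_def, hk1_def]
        ring
      · simp [hA_def, hJ_def, hG_def, hg1_def, hg.slice_eq_zero hy]
    · simp [hA_def, hF_def, hf1_def, hf.slice_eq_zero hx]
  have hkint : Integrable (fun p : (Fin d → ℝ) × (Fin d → ℝ) =>
      f1 p.1 * (g1 p.2 * log (k1 (√t • p.1 + √(1 - t) • p.2)))) (volume.prod volume) := by
    refine integrable_prod_of_abs_le_mul (q := fun y => g1 y * L') (by fun_prop) hf1.integrable
      (hg1.integrable.mul_const L') fun x y => ?_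
    rw [abs_mul, abs_mul, abs_of_nonneg (hf1.nonneg x), abs_of_nonneg (hg1.nonneg y)]
    exact mul_le_mul_of_nonneg_left (mul_le_mul_of_nonneg_left (hk1.abs_log_le hL' _)
      (hg1.nonneg y)) (hf1.nonneg x)
  have i1 := ((hFi.mul_prod (hg1.integrable (μ := volume))).const_mul t)
  have i2 := (((hf1.integrable (μ := volume)).mul_prod hGi).const_mul (1 - t))
  have i3 := (((hf1.integrable_mul_log (μ := volume)).mul_prod
    (hg1.integrable (μ := volume))).const_mul t)
  have i4 := (((hf1.integrable (μ := volume)).mul_prod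
    (hg1.integrable_mul_log (μ := volume))).const_mul (1 - t))
  have hmono := integral_mono hAint (((i1.add i2).sub (i3.add i4)).add hkint)
    fun p => hpt p.1 p.2
  rw [integral_add' ((i1.add i2).sub (i3.add i4)) hkint, integral_sub' (i1.add i2) (i3.add i4),
    integral_add' i1 i2, integral_add' i3 i4] at hmono
  simp only [integral_const_mul] at hmono
  rw [integral_prod_mul, integral_prod_mul, integral_prod_mul (fun x => f1 x * log (f1 x)),
    integral_prod_mul _ (fun y => g1 y * log (g1 y)), integral_prod _ hkint] at hmono
  simp only [integral_const_mul] at hmono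
  rw [hlhs]
  rw [hmf, hmg, hmk] at hIH
  rw [hmf, hmg, hF, hG] at hmono
  linarith

lemma GibbsInequality.of_measurableEquiv {t : ℝ} {E F : Type*} [NormedAddCommGroup E]
    [NormedSpace ℝ E] [MeasureSpace E] [NormedAddCommGroup F] [NormedSpace ℝ F] [MeasureSpace F]
    (h : GibbsInequality t E) (e : E ≃ᵐ F) (he : MeasurePreserving e)
    (hnorm : ∀ x, ‖e x‖ = ‖x‖)
    (hlin : ∀ (a b : ℝ) (x y : E), e (a • x + b • y) = a • e x + b • e y) :
    GibbsInequality t F := by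
  intro R L f g k hR hL hf hg hk
  have htame : ∀ {R : ℝ} {f : F → ℝ}, IsTame R L f → IsTame R L (fun x => f (e x)) :=
    fun hf => ⟨hf.measurable.comp e.measurable, fun x hx => hf.exp_neg_le _ (by rwa [hnorm]),
      fun x hx => hf.le_exp _ (by rwa [hnorm]), fun x hx => hf.eq_zero _ (by rwa [hnorm])⟩
  have key := h R L _ _ _ hR hL (htame hf) (htame hg) (htame hk)
  simp only [hlin] at key
  have hi : ∀ p : F → ℝ, ∫ x, p (e x) = ∫ x, p x := fun p => he.integral_comp' p
  have h1 : ∀ x, ∫ y, g (e y) * log (k (√t • x + √(1 - t) • e y)) =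
      ∫ y, g y * log (k (√t • x + √(1 - t) • y)) := fun x =>
    hi fun y => g y * log (k (√t • x + √(1 - t) • y))
  simp only [h1] at key
  rwa [hi f, hi g, hi k, hi fun x => f x * log (f x), hi fun x => g x * log (g x),
    hi fun x => f x * ∫ y, g y * log (k (√t • x + √(1 - t) • y))] at key

lemma gibbsInequality_fin_zero {t : ℝ} : GibbsInequality t (Fin 0 → ℝ) := by
  intro R L f g k hR hL hf hg hk
  have hi : ∀ p : (Fin 0 → ℝ) → ℝ, ∫ x, p x = p 0 := fun p => by
    rw [volume_pi, Measure.pi_of_empty _ 0, integral_dirac]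
  simp only [hi]
  rw [Subsingleton.elim (√t • (0 : Fin 0 → ℝ) + √(1 - t) • 0) 0]
  refine le_of_eq ?_
  ring

lemma gibbsInequality_fin {t : ℝ} (ht : t ∈ Ioo (0 : ℝ) 1) (d : ℕ) :
    GibbsInequality t (Fin d → ℝ) := by
  induction d with
  | zero => exact gibbsInequality_fin_zero
  | succ d ih =>
    have he := (volume_preserving_piFinSuccAbove (fun _ : Fin (d + 1) => ℝ) 0).symm
    have happ : ∀ x : ℝ × (Fin d → ℝ),
        (MeasurableEquiv.piFinSuccAbove (fun _ : Fin (d + 1) => ℝ) 0).symm x =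
          Fin.cons x.1 x.2 := fun x => by
      simp [MeasurableEquiv.piFinSuccAbove, Fin.insertNthEquiv]
    refine (gibbsInequality_real_prod ht ih).of_measurableEquiv _ he (fun x => ?_)
      fun a b x y => ?_
    · rw [happ]
      refine le_antisymm ((pi_norm_le_iff_of_nonneg (norm_nonneg x)).2 fun i => ?_)
        (max_le ?_ ((pi_norm_le_iff_of_nonneg (norm_nonneg _)).2 fun i => ?_))
      · refine Fin.cases ?_ (fun i => ?_) i
        · exact norm_fst_le x
        · exact (norm_le_pi_norm x.2 i).trans (norm_snd_le x)
      · exact norm_le_pi_norm (Fin.cons x.1 x.2 : Fin (d + 1) → ℝ) 0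
      · exact norm_le_pi_norm (Fin.cons x.1 x.2 : Fin (d + 1) → ℝ) i.succ
    · simp only [happ]
      ext i
      refine Fin.cases ?_ (fun i => ?_) i <;> simp

/-- `f` takes values in `[0, M]` and vanishes outside the closed ball of radius `R`. -/
structure IsTruncated {d : ℕ} (R M : ℝ) (f : (Fin d → ℝ) → ℝ) : Prop where
  measurable : Measurable f
  nonneg : ∀ x, 0 ≤ f x
  le : ∀ x, f x ≤ M
  eq_zero : ∀ x, R < ‖x‖ → f x = 0

/-- `f` shifted up by `ε` on the closed ball of radius `R`. -/
def ballShift {d : ℕ} (R ε : ℝ) (f : (Fin d → ℝ) → ℝ) : (Fin d → ℝ) → ℝ :=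
  fun x => f x + (Metric.closedBall 0 R).indicator (fun _ => ε) x

lemma tendsto_ballShift {d : ℕ} (R : ℝ) (f : (Fin d → ℝ) → ℝ) (x : Fin d → ℝ) :
    Tendsto (fun n : ℕ => ballShift R (1 / ((n : ℝ) + 1)) f x) atTop (𝓝 (f x)) := by
  by_cases hx : x ∈ Metric.closedBall 0 R
  · simpa [ballShift, hx] using tendsto_one_div_add_atTop_nhds_zero_nat.const_add (f x)
  · simp [ballShift, hx]

lemma integrable_indicator_closedBall (d : ℕ) (R c : ℝ) :
    Integrable ((Metric.closedBall (0 : Fin d → ℝ) R).indicator fun _ => c) :=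
  (integrable_indicator_iff Metric.isClosed_closedBall.measurableSet).2
    (integrableOn_const (isCompact_closedBall 0 R).measure_lt_top.ne)

namespace IsTruncated

variable {d : ℕ} {R M : ℝ} {f : (Fin d → ℝ) → ℝ}

lemma bound_nonneg (hf : IsTruncated R M f) : 0 ≤ M := (hf.nonneg 0).trans (hf.le 0)

lemma norm_comp_le (hf : IsTruncated R M f) {φ : ℝ → ℝ} (hφ0 : φ 0 = 0) {C : ℝ}
    (hC : ∀ s ∈ Icc 0 M, ‖φ s‖ ≤ C) (x : Fin d → ℝ) :
    ‖φ (f x)‖ ≤ (Metric.closedBall 0 R).indicator (fun _ => C) x := by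
  by_cases hx : x ∈ Metric.closedBall 0 R
  · simpa [hx] using hC _ ⟨hf.nonneg x, hf.le x⟩
  · rw [indicator_of_notMem hx, hf.eq_zero x (by simpa using hx), hφ0, norm_zero]

lemma integrable (hf : IsTruncated R M f) : Integrable f :=
  (integrable_indicator_closedBall d R M).mono' hf.measurable.aestronglyMeasurable
    (ae_of_all _ (hf.norm_comp_le (φ := id) rfl fun s hs => by
      simpa [abs_of_nonneg hs.1] using hs.2))

lemma tendsto_integral_comp {F : ℕ → (Fin d → ℝ) → ℝ} (hF : ∀ n, IsTruncated R M (F n))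
    (hlim : ∀ x, Tendsto (fun n => F n x) atTop (𝓝 (f x))) {φ : ℝ → ℝ} (hφ : Continuous φ)
    (hφ0 : φ 0 = 0) :
    Tendsto (fun n => ∫ x, φ (F n x)) atTop (𝓝 (∫ x, φ (f x))) := by
  obtain ⟨C, hC⟩ := isCompact_Icc.exists_bound_of_continuousOn (s := Icc 0 M) hφ.continuousOn
  exact tendsto_integral_of_dominated_convergence _
    (fun n => (hφ.measurable.comp (hF n).measurable).aestronglyMeasurable)
    (integrable_indicator_closedBall d R C)
    (fun n => ae_of_all _ ((hF n).norm_comp_le hφ0 hC))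
    (ae_of_all _ fun x => (hφ.tendsto _).comp (hlim x))

lemma measurable_ballShift (hf : IsTruncated R M f) (ε : ℝ) : Measurable (ballShift R ε f) :=
  hf.measurable.add (measurable_const.indicator Metric.isClosed_closedBall.measurableSet)

lemma isTruncated_ballShift (hf : IsTruncated R M f) {ε : ℝ} (h0 : 0 ≤ ε) (h1 : ε ≤ 1) :
    IsTruncated R (M + 1) (ballShift R ε f) where
  measurable := hf.measurable_ballShift ε
  nonneg x := add_nonneg (hf.nonneg x) (indicator_nonneg (fun _ _ => h0) x)
  le x := add_le_add (hf.le x) (indicator_apply_le' (fun _ => h1) fun _ => zero_le_one)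
  eq_zero x hx := by
    simp [ballShift, hf.eq_zero x hx, indicator_of_notMem, hx]

lemma isTame_ballShift (hf : IsTruncated R M f) {ε : ℝ} (h0 : 0 < ε) (h1 : ε ≤ 1) :
    IsTame R (|log ε| + |log (M + 1)|) (ballShift R ε f) where
  measurable := hf.measurable_ballShift ε
  exp_neg_le x hx := by
    have h : ε ≤ ballShift R ε f x := by
      have hm : x ∈ Metric.closedBall 0 R := by simpa using hx
      simpa [ballShift, hm] using hf.nonneg x
    refine le_trans ?_ h
    conv_rhs => rw [← exp_log h0]
    exact exp_le_exp.2 (by linarith [neg_abs_le (log ε), abs_nonneg (log (M + 1))])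
  le_exp x hx := by
    refine ((hf.isTruncated_ballShift h0.le h1).le x).trans ?_
    have hM : 0 < M + 1 := by linarith [hf.bound_nonneg]
    conv_lhs => rw [← exp_log hM]
    exact exp_le_exp.2 (by linarith [le_abs_self (log (M + 1)), abs_nonneg (log ε)])
  eq_zero := (hf.isTruncated_ballShift h0.le h1).eq_zero

end IsTruncated

lemma integral_mul_log_le_of_isTruncated {t : ℝ} (ht : t ∈ Ioo (0 : ℝ) 1) {d : ℕ} {R M L : ℝ}
    (hR : 0 < R) {f g k : (Fin d → ℝ) → ℝ} (hf : IsTruncated R M f) (hg : IsTruncated R M g)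
    (hk : IsTame (2 * R) L k) (hf0 : ∫ x, f x ≠ 0) (hg0 : ∫ x, g x ≠ 0) :
    ∫ x, f x * ∫ y, g y * log (k (√t • x + √(1 - t) • y)) ≤
      t * (∫ y, g y) * (∫ x, f x * log (f x)) + (1 - t) * (∫ x, f x) * (∫ y, g y * log (g y)) -
      (∫ x, f x) * (∫ y, g y) *
        (t * log (∫ x, f x) + (1 - t) * log (∫ y, g y) - log (∫ z, k z)) := by
  set ε : ℕ → ℝ := fun n => 1 / ((n : ℝ) + 1) with hε
  have hε0 : ∀ n, 0 < ε n := fun n => by positivity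
  have hε1 : ∀ n, ε n ≤ 1 := fun n => by
    rw [hε, div_le_one (by positivity)]
    linarith [(Nat.cast_nonneg n : (0 : ℝ) ≤ n)]
  set F : ℕ → (Fin d → ℝ) → ℝ := fun n => ballShift R (ε n) f
  set G : ℕ → (Fin d → ℝ) → ℝ := fun n => ballShift R (ε n) g
  have hF : ∀ n, IsTruncated R (M + 1) (F n) := fun n => hf.isTruncated_ballShift (hε0 n).le (hε1 n)
  have hG : ∀ n, IsTruncated R (M + 1) (G n) := fun n => hg.isTruncated_ballShift (hε0 n).le (hε1 n)
  have hFl : ∀ x, Tendsto (fun n => F n x) atTop (𝓝 (f x)) := tendsto_ballShift R f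
  have hGl : ∀ x, Tendsto (fun n => G n x) atTop (𝓝 (g x)) := tendsto_ballShift R g
  have hkm := hk.measurable
  have hkL := (hk.mono (le_abs_self L)).abs_log_le (abs_nonneg L)
  have hiter : ∀ {p q : (Fin d → ℝ) → ℝ}, IsTruncated R (M + 1) p → IsTruncated R (M + 1) q →
      ∫ x, p x * ∫ y, q y * log (k (√t • x + √(1 - t) • y)) =
        ∫ z : (Fin d → ℝ) × (Fin d → ℝ), p z.1 * (q z.2 * log (k (√t • z.1 + √(1 - t) • z.2)))
          ∂(volume.prod volume) := by
    intro p q hp hq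
    have hpm := hp.measurable
    have hqm := hq.measurable
    simp only [← integral_const_mul]
    rw [integral_prod]
    refine integrable_prod_of_abs_le_mul (q := fun y => q y * |L|) ?_ hp.integrable
      (hq.integrable.mul_const _) fun x y => ?_
    · fun_prop
    · rw [abs_mul, abs_mul, abs_of_nonneg (hp.nonneg x), abs_of_nonneg (hq.nonneg y)]
      exact mul_le_mul_of_nonneg_left (mul_le_mul_of_nonneg_left (hkL _) (hq.nonneg y))
        (hp.nonneg x)
  have hM : ∀ {p : (Fin d → ℝ) → ℝ}, IsTruncated R M p → IsTruncated R (M + 1) p := fun hp =>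
    ⟨hp.measurable, hp.nonneg, fun x => (hp.le x).trans (by linarith), hp.eq_zero⟩
  have hlhs : Tendsto (fun n => ∫ x, F n x * ∫ y, G n y * log (k (√t • x + √(1 - t) • y))) atTop
      (𝓝 (∫ x, f x * ∫ y, g y * log (k (√t • x + √(1 - t) • y)))) := by
    rw [hiter (hM hf) (hM hg)]
    simp_rw [hiter (hF _) (hG _)]
    refine tendsto_integral_of_dominated_convergence
      (fun z => (Metric.closedBall 0 R).indicator (fun _ => M + 1) z.1 *
        ((Metric.closedBall 0 R).indicator (fun _ => M + 1) z.2 * |L|))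
      (fun n => ?_) ?_ (fun n => ?_) (ae_of_all _ fun z => (hFl _).mul ((hGl _).mul_const _))
    · have := (hF n).measurable
      have := (hG n).measurable
      exact Measurable.aestronglyMeasurable (by fun_prop)
    · exact (integrable_indicator_closedBall d R _).mul_prod
        ((integrable_indicator_closedBall d R _).mul_const _)
    · have hb : ∀ {p : (Fin d → ℝ) → ℝ}, IsTruncated R (M + 1) p → ∀ x,
          ‖p x‖ ≤ (Metric.closedBall 0 R).indicator (fun _ => M + 1) x := fun hp =>
        hp.norm_comp_le (φ := id) rfl fun s hs => by simpa [abs_of_nonneg hs.1] using hs.2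
      refine ae_of_all _ fun z => ?_
      rw [norm_mul, norm_mul]
      have h1 := hb (hF n) z.1
      have h2 := hb (hG n) z.2
      gcongr
      · exact (norm_nonneg _).trans h1
      · exact (norm_nonneg _).trans h2
      · exact hkL _
  have hmF : Tendsto (fun n => ∫ x, F n x) atTop (𝓝 (∫ x, f x)) :=
    IsTruncated.tendsto_integral_comp hF hFl continuous_id rfl
  have hmG : Tendsto (fun n => ∫ x, G n x) atTop (𝓝 (∫ x, g x)) :=
    IsTruncated.tendsto_integral_comp hG hGl continuous_id rfl
  have hlF : Tendsto (fun n => ∫ x, F n x * log (F n x)) atTop (𝓝 (∫ x, f x * log (f x))) :=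
    IsTruncated.tendsto_integral_comp hF hFl continuous_mul_log (by simp)
  have hlG : Tendsto (fun n => ∫ x, G n x * log (G n x)) atTop (𝓝 (∫ x, g x * log (g x))) :=
    IsTruncated.tendsto_integral_comp hG hGl continuous_mul_log (by simp)
  refine le_of_tendsto_of_tendsto' hlhs ((((hmG.const_mul t).mul hlF).add
    ((hmF.const_mul (1 - t)).mul hlG)).sub ((hmF.mul hmG).mul
      ((((hmF.log hf0).const_mul t).add ((hmG.log hg0).const_mul (1 - t))).sub_const _)))
    fun n => ?_
  have hL1 : |log (ε n)| + |log (M + 1)| ≤ |log (ε n)| + |log (M + 1)| + |L| := by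
    linarith [abs_nonneg L]
  refine gibbsInequality_fin ht d R (|log (ε n)| + |log (M + 1)| + |L|) (F n) (G n) k hR
    (by positivity) ((hf.isTame_ballShift (hε0 n) (hε1 n)).mono hL1)
    ((hg.isTame_ballShift (hε0 n) (hε1 n)).mono hL1) (hk.mono ?_)
  linarith [le_abs_self L, abs_nonneg (log (ε n)), abs_nonneg (log (M + 1))]

lemma measurable_scaleDensity {d : ℕ} (t : ℝ) {f : (Fin d → ℝ) → ℝ} (hf : Measurable f) :
    Measurable (scaleDensity d t f) := by
  unfold scaleDensity
  fun_prop

lemma scaleDensity_nonneg {d : ℕ} {t : ℝ} (ht : 0 < t) {f : (Fin d → ℝ) → ℝ} (hf : ∀ x, 0 ≤ f x)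
    (x : Fin d → ℝ) : 0 ≤ scaleDensity d t f x :=
  mul_nonneg (rpow_nonneg ht.le _) (hf _)

lemma scaleDensity_mono {d : ℕ} {t : ℝ} (ht : 0 < t) {f f' : (Fin d → ℝ) → ℝ}
    (h : ∀ x, f x ≤ f' x) (x : Fin d → ℝ) : scaleDensity d t f x ≤ scaleDensity d t f' x :=
  mul_le_mul_of_nonneg_left (h _) (rpow_nonneg ht.le _)

lemma integrable_scaleDensity {d : ℕ} {t : ℝ} (ht : 0 < t) {f : (Fin d → ℝ) → ℝ}
    (hf : Integrable f) : Integrable (scaleDensity d t f) :=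
  (hf.comp_smul (inv_ne_zero (sqrt_pos.2 ht).ne')).const_mul _

lemma integral_scaleDensity_mul {d : ℕ} {t : ℝ} (ht : 0 < t) (f ψ : (Fin d → ℝ) → ℝ) :
    ∫ u, scaleDensity d t f u * ψ u = ∫ x, f x * ψ (√t • x) := by
  have hs : √t ≠ 0 := (sqrt_pos.2 ht).ne'
  have h := Measure.integral_comp_inv_smul volume (fun x => f x * ψ (√t • x)) (√t)
  simp only [smul_inv_smul₀ hs, Module.finrank_fin_fun, smul_eq_mul] at h
  simp only [scaleDensity, mul_assoc]
  rw [integral_const_mul, h, abs_of_nonneg (by positivity), ← mul_assoc]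
  have : t ^ (-(d : ℝ) / 2) * √t ^ d = 1 := by
    rw [sqrt_eq_rpow, ← rpow_natCast, ← rpow_mul ht.le, ← rpow_add ht]
    ring_nf
    exact rpow_zero t
  rw [this, one_mul]

section WeightedConvolution

variable {d : ℕ} {t : ℝ} {f g : (Fin d → ℝ) → ℝ}

lemma measurable_wconv (hf : Measurable f) (hg : Measurable g) : Measurable (wconv d t f g) := by
  have h1 := measurable_scaleDensity t hf
  have h2 := measurable_scaleDensity (1 - t) hg
  have : Measurable fun p : (Fin d → ℝ) × (Fin d → ℝ) =>
      scaleDensity d t f p.2 * scaleDensity d (1 - t) g (p.1 - p.2) := by fun_prop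
  exact this.stronglyMeasurable.integral_prod_right'.measurable

lemma wconv_nonneg (ht : t ∈ Ioo (0 : ℝ) 1) (hf : ∀ x, 0 ≤ f x) (hg : ∀ x, 0 ≤ g x)
    (z : Fin d → ℝ) : 0 ≤ wconv d t f g z :=
  integral_nonneg fun _ => mul_nonneg (scaleDensity_nonneg ht.1 hf _)
    (scaleDensity_nonneg (sub_pos.2 ht.2) hg _)

lemma integrable_wconv_integrand (ht : t ∈ Ioo (0 : ℝ) 1) (hf : Integrable f)
    (hg : Integrable g) :
    Integrable (fun p : (Fin d → ℝ) × (Fin d → ℝ) =>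
      scaleDensity d t f p.2 * scaleDensity d (1 - t) g (p.1 - p.2)) (volume.prod volume) :=
  (integrable_scaleDensity ht.1 hf).convolution_integrand (ContinuousLinearMap.mul ℝ ℝ)
    (integrable_scaleDensity (sub_pos.2 ht.2) hg)

lemma integrable_wconv (ht : t ∈ Ioo (0 : ℝ) 1) (hf : Integrable f) (hg : Integrable g) :
    Integrable (wconv d t f g) :=
  (integrable_wconv_integrand ht hf hg).integral_prod_left

lemma integral_wconv_mul (ht : t ∈ Ioo (0 : ℝ) 1) (hf : Integrable f) (hg : Integrable g)
    {φ : (Fin d → ℝ) → ℝ} (hφ : Measurable φ) {C : ℝ} (hC : ∀ x, |φ x| ≤ C) :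
    ∫ z, wconv d t f g z * φ z = ∫ x, f x * ∫ y, g y * φ (√t • x + √(1 - t) • y) := by
  have hint : Integrable (fun p : (Fin d → ℝ) × (Fin d → ℝ) =>
      scaleDensity d t f p.2 * scaleDensity d (1 - t) g (p.1 - p.2) * φ p.1)
      (volume.prod volume) :=
    (integrable_wconv_integrand ht hf hg).mul_bdd (c := C)
      (hφ.comp measurable_fst).aestronglyMeasurable (ae_of_all _ fun p => hC _)
  calc ∫ z, wconv d t f g z * φ z
      = ∫ z, ∫ u, scaleDensity d t f u * scaleDensity d (1 - t) g (z - u) * φ z := by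
        simp only [integral_mul_const]
        rfl
    _ = ∫ u, ∫ z, scaleDensity d t f u * scaleDensity d (1 - t) g (z - u) * φ z :=
        integral_integral_swap hint
    _ = ∫ u, scaleDensity d t f u * ∫ v, scaleDensity d (1 - t) g v * φ (u + v) := by
        refine integral_congr_ae (ae_of_all _ fun u => ?_)
        simp only [mul_assoc]
        rw [integral_const_mul, ← integral_add_left_eq_self _ u]
        simp only [add_sub_cancel_left]
    _ = _ := by
        rw [integral_scaleDensity_mul ht.1]
        refine integral_congr_ae (ae_of_all _ fun x => ?_)
        simp only
        rw [integral_scaleDensity_mul (sub_pos.2 ht.2)]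

lemma integral_wconv (ht : t ∈ Ioo (0 : ℝ) 1) (hf : Integrable f) (hg : Integrable g) :
    ∫ z, wconv d t f g z = (∫ x, f x) * ∫ y, g y := by
  have := integral_wconv_mul ht hf hg (φ := fun _ => 1) measurable_const (C := 1) (by simp)
  simpa [integral_mul_const] using this

lemma isTruncated_wconv (ht : t ∈ Ioo (0 : ℝ) 1) {R M : ℝ} (hf : IsTruncated R M f)
    (hg : IsTruncated R M g) : ∃ M', IsTruncated (2 * R) M' (wconv d t f g) := by
  have hb := sub_pos.2 ht.2
  refine ⟨∫ u, scaleDensity d t f u * ((1 - t) ^ (-(d : ℝ) / 2) * M),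
    measurable_wconv hf.measurable hg.measurable, wconv_nonneg ht hf.nonneg hg.nonneg,
    fun z => ?_, fun z hz => ?_⟩
  · refine integral_mono_of_nonneg (ae_of_all _ fun u => mul_nonneg
      (scaleDensity_nonneg ht.1 hf.nonneg _) (scaleDensity_nonneg hb hg.nonneg _))
      ((integrable_scaleDensity ht.1 hf.integrable).mul_const _) (ae_of_all _ fun u => ?_)
    exact mul_le_mul_of_nonneg_left (mul_le_mul_of_nonneg_left (hg.le _) (rpow_nonneg hb.le _))
      (scaleDensity_nonneg ht.1 hf.nonneg _)
  · refine integral_eq_zero_of_ae (ae_of_all _ fun u => ?_)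
    by_contra h
    obtain ⟨h1, h2⟩ := mul_ne_zero_iff.1 h
    have h1' : ‖(√t)⁻¹ • u‖ ≤ R := not_lt.1 fun hlt =>
      (mul_ne_zero_iff.1 h1).2 (hf.eq_zero _ hlt)
    have h2' : ‖(√(1 - t))⁻¹ • (z - u)‖ ≤ R := not_lt.1 fun hlt =>
      (mul_ne_zero_iff.1 h2).2 (hg.eq_zero _ hlt)
    have := norm_sqrt_smul_add_le ht h1' h2'
    rw [smul_inv_smul₀ (sqrt_pos.2 ht.1).ne', smul_inv_smul₀ (sqrt_pos.2 hb).ne',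
      add_sub_cancel] at this
    exact absurd hz (not_lt.2 this)

lemma integral_wconv_mul_log_le_of_isTruncated (ht : t ∈ Ioo (0 : ℝ) 1) {R M : ℝ} (hR : 0 < R)
    (hf : IsTruncated R M f) (hg : IsTruncated R M g) (hf0 : ∫ x, f x ≠ 0)
    (hg0 : ∫ x, g x ≠ 0) :
    ∫ z, wconv d t f g z * log (wconv d t f g z) ≤
      t * (∫ y, g y) * (∫ x, f x * log (f x)) + (1 - t) * (∫ x, f x) * (∫ y, g y * log (g y)) -
      (∫ x, f x) * (∫ y, g y) *
        (t * log (∫ x, f x) + (1 - t) * log (∫ y, g y) - log ((∫ x, f x) * ∫ y, g y)) := by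
  obtain ⟨M', hh⟩ := isTruncated_wconv ht hf hg
  set h := wconv d t f g
  set ε : ℕ → ℝ := fun n => 1 / ((n : ℝ) + 1) with hε
  have hε0 : ∀ n, 0 < ε n := fun n => by positivity
  have hε1 : ∀ n, ε n ≤ 1 := fun n => by
    rw [hε, div_le_one (by positivity)]
    linarith [(Nat.cast_nonneg n : (0 : ℝ) ≤ n)]
  have hlim : Tendsto (fun n => ∫ z, ballShift (2 * R) (ε n) h z) atTop
      (𝓝 ((∫ x, f x) * ∫ y, g y)) := by
    rw [← integral_wconv ht hf.integrable hg.integrable]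
    exact IsTruncated.tendsto_integral_comp
      (fun n => hh.isTruncated_ballShift (hε0 n).le (hε1 n)) (tendsto_ballShift _ h)
      continuous_id rfl
  refine ge_of_tendsto' (tendsto_const_nhds.sub (tendsto_const_nhds.mul
    (tendsto_const_nhds.sub (hlim.log (mul_ne_zero hf0 hg0))))) fun n => ?_
  have hk := hh.isTame_ballShift (hε0 n) (hε1 n)
  have hkL := hk.abs_log_le (by positivity)
  refine le_trans ?_ (integral_mul_log_le_of_isTruncated ht hR hf hg hk hf0 hg0)
  rw [← integral_wconv_mul ht hf.integrable hg.integrable hk.measurable.log hkL]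
  obtain ⟨C, hC⟩ := isCompact_Icc.exists_bound_of_continuousOn (s := Icc 0 M')
    continuous_mul_log.continuousOn
  refine integral_mono ((integrable_indicator_closedBall d (2 * R) C).mono'
      (continuous_mul_log.measurable.comp hh.measurable).aestronglyMeasurable
      (ae_of_all _ (hh.norm_comp_le (φ := fun x => x * log x) (by simp) hC)))
    (hh.integrable.mul_bdd hk.measurable.log.aestronglyMeasurable (ae_of_all _ hkL))
    fun z => ?_
  rcases (hh.nonneg z).eq_or_lt with hz | hz
  · simp only [← hz, h, zero_mul, le_refl]
  · refine mul_le_mul_of_nonneg_left (log_le_log hz ?_) hz.le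
    exact le_add_of_nonneg_right (indicator_nonneg (fun _ _ => (hε0 n).le) z)

end WeightedConvolution

/-- `f` cut off outside the closed ball of radius `n + 1` and where it exceeds `n + 1`. -/
def cutoff {d : ℕ} (f : (Fin d → ℝ) → ℝ) (n : ℕ) : (Fin d → ℝ) → ℝ :=
  {x | ‖x‖ ≤ (n : ℝ) + 1 ∧ f x ≤ (n : ℝ) + 1}.indicator f

section Cutoff

variable {d : ℕ} {f : (Fin d → ℝ) → ℝ}

lemma cutoff_le (hf0 : ∀ x, 0 ≤ f x) (n : ℕ) (x : Fin d → ℝ) : cutoff f n x ≤ f x :=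
  indicator_le_self' (fun x _ => hf0 x) x

lemma isTruncated_cutoff (hf : Measurable f) (hf0 : ∀ x, 0 ≤ f x) (n : ℕ) :
    IsTruncated ((n : ℝ) + 1) ((n : ℝ) + 1) (cutoff f n) where
  measurable := hf.indicator
    ((measurableSet_le measurable_norm measurable_const).inter
      (measurableSet_le hf measurable_const))
  nonneg := indicator_nonneg fun x _ => hf0 x
  le := fun _ => indicator_apply_le' (fun h => h.2) fun _ => by positivity
  eq_zero := fun _ hx => indicator_of_notMem (fun h => not_lt.2 h.1 hx) _

lemma eventually_cutoff_eq (f : (Fin d → ℝ) → ℝ) (x : Fin d → ℝ) :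
    ∀ᶠ n in atTop, cutoff f n x = f x := by
  obtain ⟨N, hN⟩ := exists_nat_ge (max ‖x‖ (f x))
  filter_upwards [eventually_ge_atTop N] with n hn
  have hn' : (N : ℝ) ≤ n := Nat.cast_le.2 hn
  rw [cutoff]
  refine indicator_of_mem (mem_ofPred_eq ▸ ⟨?_, ?_⟩) f
  · linarith [le_max_left ‖x‖ (f x)]
  · linarith [le_max_right ‖x‖ (f x)]

lemma tendsto_integral_comp_cutoff (hf : Measurable f) (hf0 : ∀ x, 0 ≤ f x) {φ : ℝ → ℝ}
    (hφ : Measurable φ) (hφ0 : φ 0 = 0) (hint : Integrable fun x => φ (f x)) :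
    Tendsto (fun n => ∫ x, φ (cutoff f n x)) atTop (𝓝 (∫ x, φ (f x))) := by
  refine tendsto_integral_of_dominated_convergence (fun x => ‖φ (f x)‖)
    (fun n => (hφ.comp (isTruncated_cutoff hf hf0 n).measurable).aestronglyMeasurable)
    hint.norm (fun n => ae_of_all _ fun x => ?_) (ae_of_all _ fun x => ?_)
  · by_cases hx : x ∈ {x | ‖x‖ ≤ (n : ℝ) + 1 ∧ f x ≤ (n : ℝ) + 1}
    · rw [cutoff, indicator_of_mem hx]
    · rw [cutoff, indicator_of_notMem hx, hφ0, norm_zero]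
      exact norm_nonneg _
  · exact tendsto_const_nhds.congr' ((eventually_cutoff_eq f x).mono fun n hn => by simp only [hn])

end Cutoff

lemma abs_mul_log_le {s r : ℝ} (hs : 0 ≤ s) (hsr : s ≤ r) : |s * log s| ≤ |r * log r| + r := by
  rcases hs.eq_or_lt with rfl | hs
  · simpa using add_nonneg (abs_nonneg (r * log r)) hsr
  have hr : 0 < r := hs.trans_le hsr
  have h1 : |s * log r| ≤ |r * log r| := by
    rw [abs_mul, abs_mul, abs_of_pos hs, abs_of_pos hr]
    gcongr
  have h2 : s * log s ≤ s * log r := mul_le_mul_of_nonneg_left (log_le_log hs hsr) hs.le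
  have h3 : s * (log r - log s) ≤ r - s := by
    rw [← log_div hr.ne' hs.ne']
    calc s * log (r / s) ≤ s * (r / s - 1) :=
          mul_le_mul_of_nonneg_left (log_le_sub_one_of_pos (by positivity)) hs.le
      _ = r - s := by field_simp
  have h4 := abs_le.1 h1
  rw [abs_le]
  constructor <;> linarith [h4.1, h4.2]

lemma tendsto_integral_wconv_cutoff_mul_log {d : ℕ} {t : ℝ} (ht : t ∈ Ioo (0 : ℝ) 1)
    {f g : (Fin d → ℝ) → ℝ} (hf : Measurable f) (hg : Measurable g) (hf0 : ∀ x, 0 ≤ f x)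
    (hg0 : ∀ x, 0 ≤ g x) (hfi : Integrable f) (hgi : Integrable g)
    (hint : Integrable fun z => wconv d t f g z * log (wconv d t f g z)) :
    Tendsto (fun n => ∫ z, wconv d t (cutoff f n) (cutoff g n) z *
        log (wconv d t (cutoff f n) (cutoff g n) z)) atTop
      (𝓝 (∫ z, wconv d t f g z * log (wconv d t f g z))) := by
  have hb := sub_pos.2 ht.2
  have hF := isTruncated_cutoff hf hf0
  have hG := isTruncated_cutoff hg hg0
  have hexists := (integrable_wconv_integrand ht hfi hgi).prod_right_ae
  have hmul_le : ∀ n z u, scaleDensity d t (cutoff f n) u *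
      scaleDensity d (1 - t) (cutoff g n) (z - u) ≤
      scaleDensity d t f u * scaleDensity d (1 - t) g (z - u) := fun n z u =>
    mul_le_mul (scaleDensity_mono ht.1 (cutoff_le hf0 n) _)
      (scaleDensity_mono hb (cutoff_le hg0 n) _) (scaleDensity_nonneg hb (hG n).nonneg _)
      (scaleDensity_nonneg ht.1 hf0 _)
  have hmul_nonneg : ∀ n z u, 0 ≤ scaleDensity d t (cutoff f n) u *
      scaleDensity d (1 - t) (cutoff g n) (z - u) := fun n z u =>
    mul_nonneg (scaleDensity_nonneg ht.1 (hF n).nonneg _) (scaleDensity_nonneg hb (hG n).nonneg _)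
  refine tendsto_integral_of_dominated_convergence
    (fun z => |wconv d t f g z * log (wconv d t f g z)| + wconv d t f g z)
    (fun n => (continuous_mul_log.measurable.comp
      (measurable_wconv (hF n).measurable (hG n).measurable)).aestronglyMeasurable)
    (hint.abs.add (integrable_wconv ht hfi hgi)) (fun n => ?_) ?_
  · filter_upwards [hexists] with z hz
    exact abs_mul_log_le (wconv_nonneg ht (hF n).nonneg (hG n).nonneg z)
      (integral_mono_of_nonneg (ae_of_all _ (hmul_nonneg n z)) hz (ae_of_all _ (hmul_le n z)))
  · filter_upwards [hexists] with z hz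
    refine (continuous_mul_log.tendsto _).comp ?_
    refine tendsto_integral_of_dominated_convergence _ (fun n => ?_) hz
      (fun n => ae_of_all _ fun u => ?_) (ae_of_all _ fun u => ?_)
    · have h1 := measurable_scaleDensity t (hF n).measurable
      have h2 := measurable_scaleDensity (1 - t) (hG n).measurable
      exact Measurable.aestronglyMeasurable (by fun_prop)
    · rw [norm_of_nonneg (hmul_nonneg n z u)]
      exact hmul_le n z u
    · refine tendsto_const_nhds.congr' ?_
      filter_upwards [eventually_cutoff_eq f ((√t)⁻¹ • u),
        eventually_cutoff_eq g ((√(1 - t))⁻¹ • (z - u))] with n h1 h2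
      simp only [scaleDensity, h1, h2]

/-- **Linear form of the entropy power inequality.** For `t ∈ (0,1)` and
densities `f, g` on `ℝ^d` with finite differential entropies, if the
weighted-sum density `h_t` of `√t·X + √(1-t)·Y` has well-defined differential
entropy, then `H(h_t) ≥ t H(f) + (1-t) H(g)`. -/
theorem linear_entropy_power_inequality (d : ℕ) (hd : 1 ≤ d) (t : ℝ)
    (ht : t ∈ Set.Ioo (0 : ℝ) 1)
    (f g : (Fin d → ℝ) → ℝ) (hf : IsDensity d f) (hg : IsDensity d g)
    (hfent : Integrable (fun x : Fin d → ℝ => f x * Real.log (f x)))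
    (hgent : Integrable (fun x : Fin d → ℝ => g x * Real.log (g x)))
    (hhent : Integrable (fun x : Fin d → ℝ =>
      wconv d t f g x * Real.log (wconv d t f g x))) :
    shannonH d (wconv d t f g) ≥ t * shannonH d f + (1 - t) * shannonH d g := by
  obtain ⟨hfm, hf0, hf1⟩ := hf
  obtain ⟨hgm, hg0, hg1⟩ := hg
  have hfi : Integrable f := .of_integral_ne_zero (hf1 ▸ one_ne_zero)
  have hgi : Integrable g := .of_integral_ne_zero (hg1 ▸ one_ne_zero)
  have hmf : Tendsto (fun n => ∫ x, cutoff f n x) atTop (𝓝 1) :=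
    hf1 ▸ tendsto_integral_comp_cutoff hfm hf0 measurable_id rfl hfi
  have hmg : Tendsto (fun n => ∫ x, cutoff g n x) atTop (𝓝 1) :=
    hg1 ▸ tendsto_integral_comp_cutoff hgm hg0 measurable_id rfl hgi
  have hlf := tendsto_integral_comp_cutoff hfm hf0 continuous_mul_log.measurable (by simp) hfent
  have hlg := tendsto_integral_comp_cutoff hgm hg0 continuous_mul_log.measurable (by simp) hgent
  have key := le_of_tendsto_of_tendsto
    (tendsto_integral_wconv_cutoff_mul_log ht hfm hgm hf0 hg0 hfi hgi hhent)
    ((((hmg.const_mul t).mul hlf).add ((hmf.const_mul (1 - t)).mul hlg)).sub ((hmf.mul hmg).mul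
      ((((hmf.log one_ne_zero).const_mul t).add ((hmg.log one_ne_zero).const_mul (1 - t))).sub
        ((hmf.mul hmg).log (by norm_num)))))
    (by
      filter_upwards [hmf.eventually_ne one_ne_zero, hmg.eventually_ne one_ne_zero] with n h1 h2
      exact integral_wconv_mul_log_le_of_isTruncated ht (by positivity)
        (isTruncated_cutoff hfm hf0 n) (isTruncated_cutoff hgm hg0 n) h1 h2)
  simp only [shannonH]
  simp only [mul_one, log_one, mul_zero, add_zero, sub_zero] at key
  linarith
end
end

section
/- (Equivalence of the entropy power inequality and its linear form) Fix d ≥ 1, and consider the class 𝒟 of probability density functions on ℝ^d with finite differential entropy. The following are equivalent: (i) for all f, g ∈ 𝒟 with f⋆g ∈ 𝒟, V(f⋆g) ≥ V(f) + V(g); (ii) for all f, g ∈ 𝒟, all t ∈ (0,1), with the weighted-sum density h_t ∈ 𝒟, H(h_t) ≥ t·H(f) + (1-t)·H(g), where h_t is the density of √t·X + √(1-t)·Y for independent X ~ f, Y ~ g. -/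
open MeasureTheory Real

noncomputable section

lemma IsDensity.integrable {d : ℕ} {f : (Fin d → ℝ) → ℝ} (hf : IsDensity d f) :
    Integrable f :=
  Integrable.of_integral_ne_zero (by rw [hf.2.2]; exact one_ne_zero)

/-- The scaling factor of `scaleDensity` compensates the Jacobian of the dilation. -/
lemma integral_scaleFactor_mul_comp (d : ℕ) {t : ℝ} (ht : 0 < t) (φ : (Fin d → ℝ) → ℝ) :
    ∫ x : Fin d → ℝ, t ^ (-(d : ℝ) / 2) * φ ((Real.sqrt t)⁻¹ • x) = ∫ x, φ x := by
  have hjac : t ^ (-(d : ℝ) / 2) * Real.sqrt t ^ d = 1 := by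
    rw [Real.sqrt_eq_rpow, ← Real.rpow_natCast, ← Real.rpow_mul ht.le, ← Real.rpow_add ht]
    ring_nf
    exact Real.rpow_zero t
  rw [integral_const_mul, Measure.integral_comp_smul, Module.finrank_fin_fun, inv_pow, inv_inv,
    abs_of_nonneg (by positivity), smul_eq_mul, ← mul_assoc, hjac, one_mul]

lemma IsDensity.scaleDensity {d : ℕ} {t : ℝ} (ht : 0 < t) {f : (Fin d → ℝ) → ℝ}
    (hf : IsDensity d f) : IsDensity d (scaleDensity d t f) := by
  refine ⟨(hf.1.comp (measurable_const_smul _)).const_mul _, fun x => ?_, ?_⟩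
  · exact mul_nonneg (Real.rpow_nonneg ht.le _) (hf.2.1 _)
  · exact (integral_scaleFactor_mul_comp d ht f).trans hf.2.2

lemma scaleDensity_mul_log (d : ℕ) {t : ℝ} (ht : 0 < t) (f : (Fin d → ℝ) → ℝ)
    (x : Fin d → ℝ) :
    scaleDensity d t f x * Real.log (scaleDensity d t f x) =
      t ^ (-(d : ℝ) / 2) * (fun y => -(d : ℝ) / 2 * Real.log t * f y + f y * Real.log (f y))
        ((Real.sqrt t)⁻¹ • x) := by
  simp only [scaleDensity]
  rcases eq_or_ne (f ((Real.sqrt t)⁻¹ • x)) 0 with h | h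
  · simp [h]
  · rw [Real.log_mul (Real.rpow_pos_of_pos ht _).ne' h, Real.log_rpow ht]
    ring

lemma integrable_scaleDensity_mul_log {d : ℕ} {t : ℝ} (ht : 0 < t) {f : (Fin d → ℝ) → ℝ}
    (hf : IsDensity d f) (hfl : Integrable (fun x : Fin d → ℝ => f x * Real.log (f x))) :
    Integrable (fun x : Fin d → ℝ =>
      scaleDensity d t f x * Real.log (scaleDensity d t f x)) := by
  simp only [scaleDensity_mul_log d ht f]
  exact (((hf.integrable.const_mul _).add hfl).comp_smul
    (inv_ne_zero (Real.sqrt_pos.2 ht).ne')).const_mul _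

lemma shannonH_scaleDensity {d : ℕ} {t : ℝ} (ht : 0 < t) {f : (Fin d → ℝ) → ℝ}
    (hf : IsDensity d f) (hfl : Integrable (fun x : Fin d → ℝ => f x * Real.log (f x))) :
    shannonH d (scaleDensity d t f) = shannonH d f + (d : ℝ) / 2 * Real.log t := by
  rw [shannonH, shannonH, integral_congr_ae (.of_forall (scaleDensity_mul_log d ht f)),
    integral_scaleFactor_mul_comp d ht
      fun y => -(d : ℝ) / 2 * Real.log t * f y + f y * Real.log (f y),
    integral_add (hf.integrable.const_mul _) hfl, integral_const_mul, hf.2.2]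
  ring

lemma shannonV_scaleDensity {d : ℕ} (hd : 1 ≤ d) {t : ℝ} (ht : 0 < t) {f : (Fin d → ℝ) → ℝ}
    (hf : IsDensity d f) (hfl : Integrable (fun x : Fin d → ℝ => f x * Real.log (f x))) :
    shannonV d (scaleDensity d t f) = t * shannonV d f := by
  have hd0 : (d : ℝ) ≠ 0 := by positivity
  have h : 2 / (d : ℝ) * (shannonH d f + (d : ℝ) / 2 * Real.log t) =
      Real.log t + 2 / (d : ℝ) * shannonH d f := by
    field_simp
    ring
  rw [shannonV, shannonH_scaleDensity ht hf hfl, h, Real.exp_add, Real.exp_log ht, shannonV]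

lemma scaleDensity_scaleDensity_inv (d : ℕ) {t : ℝ} (ht : 0 < t) (f : (Fin d → ℝ) → ℝ) :
    scaleDensity d t (scaleDensity d t⁻¹ f) = f := by
  funext x
  have hs : Real.sqrt t ≠ 0 := (Real.sqrt_pos.2 ht).ne'
  have hp : t ^ (-(d : ℝ) / 2) ≠ 0 := (Real.rpow_pos_of_pos ht _).ne'
  simp only [scaleDensity, Real.sqrt_inv, inv_inv, smul_smul, mul_inv_cancel₀ hs, one_smul,
    Real.inv_rpow ht.le, mul_inv_cancel_left₀ hp]

lemma log_shannonV (d : ℕ) (f : (Fin d → ℝ) → ℝ) :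
    Real.log (shannonV d f) = 2 / (d : ℝ) * shannonH d f :=
  Real.log_exp _

/-- **Equivalence of the entropy power inequality and its linear form.** Over the
class of densities on `ℝ^d` with finite differential entropy: (i) the EPI
`V(f⋆g) ≥ V(f) + V(g)` holds whenever `f⋆g` is in the class, iff (ii) the
linear form `H(h_t) ≥ t H(f) + (1-t) H(g)` holds for all `t ∈ (0,1)` whenever
the weighted-sum density `h_t` is in the class. -/
theorem epi_iff_linear_epi (d : ℕ) (hd : 1 ≤ d) :
    (∀ f g : (Fin d → ℝ) → ℝ, IsDensity d f → IsDensity d g →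
        Integrable (fun x : Fin d → ℝ => f x * Real.log (f x)) →
        Integrable (fun x : Fin d → ℝ => g x * Real.log (g x)) →
        Integrable (fun x : Fin d → ℝ => conv d f g x * Real.log (conv d f g x)) →
        shannonV d (conv d f g) ≥ shannonV d f + shannonV d g) ↔
    (∀ f g : (Fin d → ℝ) → ℝ, IsDensity d f → IsDensity d g →
        ∀ t : ℝ, t ∈ Set.Ioo (0 : ℝ) 1 →
        Integrable (fun x : Fin d → ℝ => f x * Real.log (f x)) →
        Integrable (fun x : Fin d → ℝ => g x * Real.log (g x)) →
        Integrable (fun x : Fin d → ℝ =>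
          wconv d t f g x * Real.log (wconv d t f g x)) →
        shannonH d (wconv d t f g) ≥ t * shannonH d f + (1 - t) * shannonH d g) := by
  have hd0 : (0 : ℝ) < d := by positivity
  have hc : (0 : ℝ) < 2 / d := by positivity
  constructor
  · intro epi f g hf hg t ht hfl hgl hl
    have ht' : 0 < 1 - t := sub_pos.2 ht.2
    have key := epi _ _ (hf.scaleDensity ht.1) (hg.scaleDensity ht')
      (integrable_scaleDensity_mul_log ht.1 hf hfl)
      (integrable_scaleDensity_mul_log ht' hg hgl) hl
    rw [shannonV_scaleDensity hd ht.1 hf hfl, shannonV_scaleDensity hd ht' hg hgl] at key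
    have hconv := convexOn_exp.2 (Set.mem_univ (2 / (d : ℝ) * shannonH d f))
      (Set.mem_univ (2 / (d : ℝ) * shannonH d g)) ht.1.le ht'.le (add_sub_cancel t 1)
    have hle := Real.exp_le_exp.1 (hconv.trans key)
    simp only [smul_eq_mul] at hle
    refine le_of_mul_le_mul_left (le_of_eq_of_le ?_ hle) hc
    ring
  · intro lin f g hf hg hfl hgl hl
    have hVf : 0 < shannonV d f := Real.exp_pos _
    have hVg : 0 < shannonV d g := Real.exp_pos _
    set S := shannonV d f + shannonV d g with hS
    have hSpos : 0 < S := add_pos hVf hVg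
    set t := shannonV d f / S with ht
    have ht0 : 0 < t := div_pos hVf hSpos
    have ht1 : 1 - t = shannonV d g / S := by
      rw [ht, hS]
      field_simp
      ring
    have ht' : 0 < 1 - t := ht1 ▸ div_pos hVg hSpos
    have hw : wconv d t (scaleDensity d t⁻¹ f) (scaleDensity d (1 - t)⁻¹ g) = conv d f g := by
      rw [wconv, scaleDensity_scaleDensity_inv d ht0, scaleDensity_scaleDensity_inv d ht']
    have key := lin _ _ (hf.scaleDensity (inv_pos.2 ht0)) (hg.scaleDensity (inv_pos.2 ht')) t
      ⟨ht0, sub_pos.1 ht'⟩ (integrable_scaleDensity_mul_log (inv_pos.2 ht0) hf hfl)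
      (integrable_scaleDensity_mul_log (inv_pos.2 ht') hg hgl) (by rwa [hw])
    rw [hw] at key
    have hF : 2 / (d : ℝ) * shannonH d (scaleDensity d t⁻¹ f) = Real.log S := by
      rw [← log_shannonV, shannonV_scaleDensity hd (inv_pos.2 ht0) hf hfl, ht, inv_div,
        div_mul_cancel₀ _ hVf.ne']
    have hG : 2 / (d : ℝ) * shannonH d (scaleDensity d (1 - t)⁻¹ g) = Real.log S := by
      rw [← log_shannonV, shannonV_scaleDensity hd (inv_pos.2 ht') hg hgl, ht1, inv_div,
        div_mul_cancel₀ _ hVg.ne']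
    refine (Real.log_le_iff_le_exp hSpos).1 ?_
    refine le_of_eq_of_le ?_ (mul_le_mul_of_nonneg_left key hc.le)
    linear_combination (-t) * hF - (1 - t) * hG
end
end
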